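/- arXiv:0807.2618 — 9 statements merged into one kernel-verified Lean document; each statement's English description precedes it below -/
import Mathlib

section
/- If w ∈ W is D-anisotropic, then l(w) ≡ |S_ε| (mod 2), where S_ε denotes the set of ε-orbits on S. -/
section

set_option linter.unusedSectionVars false

variable {B : Type*} [DecidableEq B] [Fintype B]

/-- The entries of the symmetric real Cartan matrix attached to a Coxeter matrix. -/
noncomputable def CoxeterMatrix.cartanEntry (M : CoxeterMatrix B) (i j : B) : ℝ :=
  -2 * Real.cos (Real.pi / M i j)

/-- The simple coroots, as functionals on the space spanned by the simple roots. -/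
noncomputable def CoxeterMatrix.simpleCoroot (M : CoxeterMatrix B) (i : B) :
    Module.Dual ℝ (B → ℝ) :=
  Fintype.linearCombination ℝ (M.cartanEntry i)

namespace CoxeterMatrix

variable (M : CoxeterMatrix B)

lemma cartanEntry_self (i : B) : M.cartanEntry i i = 2 := by
  simp [cartanEntry]

lemma cartanEntry_comm (i j : B) : M.cartanEntry i j = M.cartanEntry j i := by
  rw [cartanEntry, M.symmetric i j, cartanEntry]

lemma simpleCoroot_single (i j : B) :
    M.simpleCoroot i (Pi.single j 1) = M.cartanEntry i j := by
  simp [simpleCoroot, Fintype.linearCombination_apply_single]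

lemma simpleCoroot_single_self (i : B) : M.simpleCoroot i (Pi.single i 1) = 2 := by
  rw [simpleCoroot_single, cartanEntry_self]

/-- The simple reflections of the geometric representation. -/
noncomputable def simpleReflection (i : B) : (B → ℝ) ≃ₗ[ℝ] (B → ℝ) :=
  Module.reflection (M.simpleCoroot_single_self i)

lemma simpleReflection_apply (i : B) (v : B → ℝ) :
    M.simpleReflection i v = v - M.simpleCoroot i v • Pi.single i 1 :=
  Module.reflection_apply _ _

variable {M}

lemma isLiftable_simpleReflection
    (hM : ∀ i j, M i j = 1 ∨ M i j = 2 ∨ M i j = 3 ∨ M i j = 4 ∨ M i j = 6) :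
    M.IsLiftable M.simpleReflection := by
  intro i j
  have key (m : ℕ) (t : ℝ) (ht : t = M.cartanEntry i j * M.cartanEntry j i - 2) (v : B → ℝ) :
      ((M.simpleReflection i * M.simpleReflection j) ^ m) v = _ :=
    Module.reflection_mul_reflection_pow_apply (M.simpleCoroot_single_self i)
      (M.simpleCoroot_single_self j) m v t
      (by rw [simpleCoroot_single, simpleCoroot_single, ht])
  have h3 : √3 * √3 = (3 : ℝ) := Real.mul_self_sqrt (by norm_num)
  have h2 : √2 * √2 = (2 : ℝ) := Real.mul_self_sqrt (by norm_num)
  ext1 v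
  rcases hM i j with h | h | h | h | h
  · obtain rfl : i = j := by
      by_contra hij
      exact M.off_diagonal i j hij h
    simp [simpleReflection_apply, simpleCoroot_single, cartanEntry_self]
    module
  · have e : M.cartanEntry i j = 0 := by simp [cartanEntry, h]
    have e' := e
    rw [cartanEntry_comm] at e'
    simp only [h, pow_two, LinearEquiv.mul_apply, simpleReflection_apply, map_sub, map_smul,
      simpleCoroot_single, cartanEntry_self, e, e', LinearEquiv.coe_one, id_eq]
    module
  · have e : M.cartanEntry i j = -1 := by
      simp [cartanEntry, h, Real.cos_pi_div_three]
    have e' := e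
    rw [cartanEntry_comm] at e'
    rw [h, key 3 (-1) (by rw [e, e']; norm_num)]
    norm_num
  · have e : M.cartanEntry i j = -√2 := by
      simp [cartanEntry, h, Real.cos_pi_div_four]; ring
    have e' := e
    rw [cartanEntry_comm] at e'
    rw [h, key 4 0 (by rw [e, e']; linarith)]
    norm_num
  · have e : M.cartanEntry i j = -√3 := by
      simp [cartanEntry, h, Real.cos_pi_div_six]; ring
    have e' := e
    rw [cartanEntry_comm] at e'
    rw [h, key 6 1 (by rw [e, e']; linarith)]
    norm_num [Polynomial.Chebyshev.S_two]

end CoxeterMatrix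

namespace Equiv.Perm

/-- The orbits of a permutation are its cycles and its fixed points. -/
lemma card_orbits_eq (σ : Equiv.Perm B) :
    Nat.card (MulAction.orbitRel.Quotient (Subgroup.zpowers σ) B) =
      σ.cycleType.card + Fintype.card (Function.fixedPoints σ) := by
  classical
  have hrel (x y : B) : (Quotient.mk (MulAction.orbitRel (Subgroup.zpowers σ) B) x =
      Quotient.mk (MulAction.orbitRel (Subgroup.zpowers σ) B) y) ↔ σ.SameCycle y x := by
    rw [Quotient.eq, MulAction.orbitRel_apply, MulAction.mem_orbit_iff]
    constructor
    · rintro ⟨⟨_, n, rfl⟩, h⟩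
      exact ⟨n, h⟩
    · rintro ⟨n, h⟩
      exact ⟨⟨_, n, rfl⟩, h⟩
  have hex (c : σ.cycleFactorsFinset) : ∃ x, x ∈ (c : Equiv.Perm B).support :=
    (mem_cycleFactorsFinset_iff.1 c.2).1.nonempty_support
  choose x hx using hex
  let F : σ.cycleFactorsFinset ⊕ Function.fixedPoints σ →
      MulAction.orbitRel.Quotient (Subgroup.zpowers σ) B :=
    Sum.elim (fun c ↦ Quotient.mk _ (x c)) (fun y ↦ Quotient.mk _ y.1)
  have hxσ (c : σ.cycleFactorsFinset) : σ (x c) ≠ x c := by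
    have := mem_cycleFactorsFinset_support_le c.2 (hx c)
    simpa using this
  have hF : Function.Bijective F := by
    constructor
    · rintro (c | y) (d | z) h
      · have h := (hrel _ _).1 h
        have := h.cycleOf_eq
        rw [← cycle_is_cycleOf (hx c) c.2, ← cycle_is_cycleOf (hx d) d.2] at this
        exact congrArg Sum.inl (Subtype.ext this.symm)
      · have h := (hrel _ _).1 h
        exact (hxσ c (h.apply_eq_self_iff.1 z.2)).elim
      · have h := (hrel _ _).1 h
        exact (hxσ d (h.apply_eq_self_iff.2 y.2)).elim
      · have h := (hrel _ _).1 h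
        exact congrArg Sum.inr (Subtype.ext (h.symm.eq_of_left y.2))
    · intro q
      induction q using Quotient.inductionOn with | _ y =>
      by_cases hy : σ y = y
      · exact ⟨.inr ⟨y, hy⟩, rfl⟩
      · have hc : σ.cycleOf y ∈ σ.cycleFactorsFinset :=
          cycleOf_mem_cycleFactorsFinset_iff.2 (by simpa using hy)
        refine ⟨.inl ⟨_, hc⟩, (hrel _ _).2 ?_⟩
        have := hx ⟨_, hc⟩
        rw [mem_support_cycleOf_iff] at this
        exact this.1
  rw [← Nat.card_congr (Equiv.ofBijective F hF)]
  simp [Nat.card_eq_fintype_card, cycleType_def]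

lemma sign_eq_neg_one_pow_card_add_card_orbits (σ : Equiv.Perm B) :
    (sign σ : ℤ) = (-1) ^ (Fintype.card B +
      Nat.card (MulAction.orbitRel.Quotient (Subgroup.zpowers σ) B)) := by
  have h := card_fixedPoints σ
  have hle : σ.cycleType.sum ≤ Fintype.card B := by
    rw [sum_cycleType]; exact Finset.card_le_univ _
  rw [sign_of_cycleType, card_orbits_eq, h]
  obtain ⟨k, hk⟩ := Nat.exists_eq_add_of_le hle
  rw [hk]
  push_cast
  rw [Nat.add_sub_cancel_left,
    show σ.cycleType.sum + k + (σ.cycleType.card + k) =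
      σ.cycleType.sum + σ.cycleType.card + 2 * k by ring, pow_add _ _ (2 * k), pow_mul]
  simp

end Equiv.Perm

namespace CoxeterSystem

variable {M : CoxeterMatrix B} {W : Type*} [Group W] (cs : CoxeterSystem M W)
  (hM : ∀ i j, M i j = 1 ∨ M i j = 2 ∨ M i j = 3 ∨ M i j = 4 ∨ M i j = 6)

/-- The geometric representation of a Coxeter group, on the space spanned by the simple roots. -/
noncomputable def geometricRep : W →* ((B → ℝ) ≃ₗ[ℝ] (B → ℝ)) :=
  cs.lift ⟨M.simpleReflection, CoxeterMatrix.isLiftable_simpleReflection hM⟩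

lemma geometricRep_simple (i : B) : cs.geometricRep hM (cs.simple i) = M.simpleReflection i :=
  cs.lift_apply_simple _ i

lemma geometricRep_simple_single (i j : B) :
    cs.geometricRep hM (cs.simple i) (Pi.single j 1) =
      Pi.single j 1 - M.cartanEntry i j • Pi.single i 1 := by
  rw [geometricRep_simple, CoxeterMatrix.simpleReflection_apply,
    CoxeterMatrix.simpleCoroot_single]

lemma sin_smul_geometricRep_alternatingWord (i j : B) (k : ℕ) :
    Real.sin (Real.pi / M i j) •
        cs.geometricRep hM (cs.wordProd (alternatingWord i j k)) (Pi.single i 1) =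
      if Even k then
        Real.sin ((k + 1) * (Real.pi / M i j)) • Pi.single i 1 +
          Real.sin (k * (Real.pi / M i j)) • Pi.single j 1
      else
        Real.sin (k * (Real.pi / M i j)) • Pi.single i 1 +
          Real.sin ((k + 1) * (Real.pi / M i j)) • Pi.single j 1 := by
  induction k with
  | zero => simp [alternatingWord]
  | succ k ih =>
    have trig : Real.sin ((k + 1 + 1) * (Real.pi / M i j)) +
        Real.sin (k * (Real.pi / M i j)) =
        2 * Real.cos (Real.pi / M i j) * Real.sin ((k + 1) * (Real.pi / M i j)) := by
      rw [show ((k : ℝ) + 1 + 1) * (Real.pi / M i j) =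
          (k + 1) * (Real.pi / M i j) + Real.pi / M i j by ring,
        show (k : ℝ) * (Real.pi / M i j) =
          (k + 1) * (Real.pi / M i j) - Real.pi / M i j by ring,
        Real.sin_add, Real.sin_sub]
      ring
    have trig' := eq_sub_of_add_eq trig
    have e : M.cartanEntry i j = -2 * Real.cos (Real.pi / M i j) := rfl
    rw [alternatingWord_succ', wordProd_cons, map_mul, LinearEquiv.mul_apply, ← map_smul, ih]
    push_cast
    rw [trig']
    by_cases hk : Even k
    · simp only [hk, if_true, Nat.even_add_one, not_true_eq_false, if_false, map_add, map_smul,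
        geometricRep_simple_single, M.cartanEntry_self, M.cartanEntry_comm j i, e]
      module
    · simp only [hk, if_true, Nat.even_add_one, not_false_eq_true, if_false, map_add, map_smul,
        geometricRep_simple_single, M.cartanEntry_self, e]
      module

lemma geometricRep_alternatingWord_mem_span_nonneg {i j : B} (hij : i ≠ j) {k : ℕ}
    (hk : k < M i j) :
    ∃ a b : ℝ, 0 ≤ a ∧ 0 ≤ b ∧
      cs.geometricRep hM (cs.wordProd (alternatingWord i j k)) (Pi.single i 1) =
        a • Pi.single i 1 + b • Pi.single j 1 := by
  have hm : 1 < M i j := by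
    have := M.off_diagonal i j hij
    omega
  have hm' : (1 : ℝ) < M i j := by exact_mod_cast hm
  have hs : 0 < Real.sin (Real.pi / M i j) :=
    Real.sin_pos_of_pos_of_lt_pi (by positivity) (div_lt_self Real.pi_pos hm')
  have hn (l : ℕ) (hl : l ≤ M i j) : 0 ≤ Real.sin (l * (Real.pi / M i j)) := by
    have hl' : (l : ℝ) ≤ M i j := by exact_mod_cast hl
    refine Real.sin_nonneg_of_nonneg_of_le_pi (by positivity) ?_
    rw [← mul_div_assoc, div_le_iff₀ (by positivity)]
    nlinarith [Real.pi_pos]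
  have h0 := hn k hk.le
  have h1 := hn (k + 1) hk
  push_cast at h1
  have key := congrArg ((Real.sin (Real.pi / M i j))⁻¹ • ·)
    (cs.sin_smul_geometricRep_alternatingWord hM i j k)
  simp only [inv_smul_smul₀ hs.ne'] at key
  rw [key]
  split_ifs
  · rw [smul_add, smul_smul, smul_smul]
    exact ⟨_, _, by positivity, by positivity, rfl⟩
  · rw [smul_add, smul_smul, smul_smul]
    exact ⟨_, _, by positivity, by positivity, rfl⟩

lemma lt_of_not_isRightDescent_alternatingWord
    (hM : ∀ i j, M i j = 1 ∨ M i j = 2 ∨ M i j = 3 ∨ M i j = 4 ∨ M i j = 6)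
    {i j : B} {k : ℕ} {v w : W}
    (hw : w = v * cs.wordProd (alternatingWord i j k)) (hl : cs.length w = cs.length v + k)
    (hi : ¬ cs.IsRightDescent w i) : k < M i j := by
  have h0 : M i j ≠ 0 := by rcases hM i j with h | h | h | h | h <;> omega
  by_contra! hk
  have hred : cs.IsReduced (alternatingWord i j k) := by
    have h1 := cs.length_wordProd_le (alternatingWord i j k)
    have h2 := cs.length_mul_le v (cs.wordProd (alternatingWord i j k))
    rw [← hw] at h2
    rw [length_alternatingWord] at h1
    rw [IsReduced, length_alternatingWord]
    omega
  obtain rfl : k = M i j := by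
    by_contra hne
    exact cs.not_isReduced_alternatingWord i j h0 (by omega) hred
  have hb := cs.wordProd_braidWord_eq i j
  rw [braidWord, braidWord, M.symmetric j i] at hb
  obtain ⟨m, hm⟩ := Nat.exists_eq_succ_of_ne_zero h0
  apply hi
  rw [hb] at hw
  rw [hm] at hw hl
  rw [alternatingWord_succ, wordProd_concat, ← mul_assoc] at hw
  have hw' : w * cs.simple i = v * cs.wordProd (alternatingWord i j m) := by
    rw [hw, simple_mul_simple_cancel_right]
  have h1 := cs.length_wordProd_le (alternatingWord i j m)
  have h2 := cs.length_mul_le v (cs.wordProd (alternatingWord i j m))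
  rw [length_alternatingWord] at h1
  rw [IsRightDescent, hw']
  omega

theorem geometricRep_nonneg_of_not_isRightDescent (w : W) (i : B)
    (hi : ¬ cs.IsRightDescent w i) : 0 ≤ cs.geometricRep hM w (Pi.single i 1) := by
  induction hn : cs.length w using Nat.strong_induction_on generalizing w i with
  | _ n ih =>
  subst hn
  by_cases h1 : w = 1
  · subst h1
    simp
  obtain ⟨j, hj⟩ := cs.exists_rightDescent_of_ne_one h1
  have hij : i ≠ j := fun h ↦ hi (h ▸ hj)
  let P : ℕ → Prop := fun k ↦ ∃ v, w = v * cs.wordProd (alternatingWord i j k) ∧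
    cs.length w = cs.length v + k
  have hP1 : P 1 := ⟨w * cs.simple j, by simp [alternatingWord],
    (cs.isRightDescent_iff.1 hj).symm⟩
  have hle (k : ℕ) (hk : P k) : k ≤ cs.length w := by
    obtain ⟨v, -, hv⟩ := hk
    omega
  classical
  obtain ⟨k, ⟨v, hw, hl⟩, hk1, hmax⟩ : ∃ k, P k ∧ 1 ≤ k ∧ ¬ P (k + 1) := by
    refine ⟨Nat.findGreatest P (cs.length w), ?_, ?_, fun h ↦ ?_⟩
    · exact Nat.findGreatest_spec (hle 1 hP1) hP1
    · exact Nat.le_findGreatest (hle 1 hP1) hP1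
    · have := Nat.le_findGreatest (hle _ h) h
      omega
  have hdesc (l : B) (hl' : l = i ∨ l = j) : ¬ cs.IsRightDescent v l := by
    intro hd
    rw [isRightDescent_iff] at hd
    obtain ⟨m, rfl⟩ := Nat.exists_eq_add_of_le' hk1
    have hcase : l = (if Even (m + 1) then j else i) ∨ l = (if Even m then j else i) := by
      by_cases hm : Even m <;> simp [hm, Nat.even_add_one] <;> tauto
    rcases hcase with h | h
    · refine hmax ⟨v * cs.simple l, ?_, by omega⟩
      rw [alternatingWord_succ', ← h, wordProd_cons, ← mul_assoc,
        simple_mul_simple_cancel_right, hw]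
    · have hw' : w = v * cs.simple l * cs.wordProd (alternatingWord i j m) := by
        rw [hw, alternatingWord_succ', ← h, wordProd_cons, mul_assoc]
      have h1 := cs.length_wordProd_le (alternatingWord i j m)
      have h2 := cs.length_mul_le (v * cs.simple l) (cs.wordProd (alternatingWord i j m))
      rw [← hw'] at h2
      rw [length_alternatingWord] at h1
      omega
  obtain ⟨a, b, ha, hb, hab⟩ := cs.geometricRep_alternatingWord_mem_span_nonneg hM hij
    (cs.lt_of_not_isRightDescent_alternatingWord hM hw hl hi)
  have hvi := ih _ (by omega) v i (hdesc i (.inl rfl)) rfl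
  have hvj := ih _ (by omega) v j (hdesc j (.inr rfl)) rfl
  rw [hw, map_mul, LinearEquiv.mul_apply, hab, map_add, map_smul, map_smul]
  exact add_nonneg (smul_nonneg ha hvi) (smul_nonneg hb hvj)

theorem geometricRep_nonpos_of_isRightDescent (w : W) (i : B)
    (hi : cs.IsRightDescent w i) : cs.geometricRep hM w (Pi.single i 1) ≤ 0 := by
  have h := cs.geometricRep_nonneg_of_not_isRightDescent hM _ i
    (cs.isRightDescent_iff_not_isRightDescent_mul.1 hi)
  rw [map_mul, LinearEquiv.mul_apply, geometricRep_simple_single, M.cartanEntry_self, map_sub,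
    map_smul] at h
  have : cs.geometricRep hM w (Pi.single i 1) -
      (2 : ℝ) • cs.geometricRep hM w (Pi.single i 1) =
      -cs.geometricRep hM w (Pi.single i 1) := by module
  rw [this] at h
  exact neg_nonneg.1 h

theorem dominant_eq_and_mem_closure (u : W) (g h : Module.Dual ℝ (B → ℝ))
    (hg : ∀ i, 0 ≤ g (Pi.single i 1)) (hh : ∀ i, 0 ≤ h (Pi.single i 1))
    (hu : ∀ v, g (cs.geometricRep hM u v) = h v) :
    h = g ∧ u ∈ Subgroup.closure (cs.simple '' {i | g (Pi.single i 1) = 0}) := by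
  induction hn : cs.length u using Nat.strong_induction_on generalizing u with
  | _ n ih =>
  subst hn
  by_cases h1 : u = 1
  · subst h1
    exact ⟨LinearMap.ext fun v ↦ by simp [← hu], one_mem _⟩
  obtain ⟨i, hi⟩ := cs.exists_rightDescent_of_ne_one h1
  have hneg := cs.geometricRep_nonpos_of_isRightDescent hM u i hi
  have hmono (v : B → ℝ) (hv : v ≤ 0) : g v ≤ 0 := by
    rw [← Finset.univ_sum_single v, map_sum]
    refine Finset.sum_nonpos fun j _ ↦ ?_
    rw [show Pi.single j (v j) = v j • (Pi.single j 1 : B → ℝ) by simp [← Pi.single_smul],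
      map_smul]
    exact mul_nonpos_of_nonpos_of_nonneg (hv j) (hg j)
  have h0 : h (Pi.single i 1) = 0 :=
    le_antisymm (hu _ ▸ hmono _ hneg) (hh i)
  obtain ⟨rfl, hmem⟩ := ih _ hi (u * cs.simple i) (fun v ↦ by
    rw [map_mul, LinearEquiv.mul_apply, hu, geometricRep_simple,
      CoxeterMatrix.simpleReflection_apply, map_sub, map_smul, h0, smul_zero, sub_zero]) rfl
  refine ⟨rfl, ?_⟩
  rw [← cs.simple_mul_simple_cancel_right (w := u) i]
  exact mul_mem hmem (Subgroup.subset_closure ⟨i, h0, rfl⟩)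

theorem exists_dominant [Finite W] (f : Module.Dual ℝ (B → ℝ)) :
    ∃ x, ∀ i, 0 ≤ f (cs.geometricRep hM x (Pi.single i 1)) := by
  have := Fintype.ofFinite W
  let γ : Module.Dual ℝ (B → ℝ) := Fintype.linearCombination ℝ (fun _ ↦ (1 : ℝ))
  have hγ (i : B) : γ (Pi.single i 1) = 1 := by
    simp [γ, Fintype.linearCombination_apply_single]
  let ρ := cs.geometricRep hM
  let form (a b : Module.Dual ℝ (B → ℝ)) : ℝ :=
    ∑ u, ∑ j, a (ρ u (Pi.single j 1)) * b (ρ u (Pi.single j 1))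
  have hinv (a b : Module.Dual ℝ (B → ℝ)) (y : W) :
      form (a ∘ₗ (ρ y).toLinearMap) (b ∘ₗ (ρ y).toLinearMap) = form a b := by
    refine Fintype.sum_equiv (Equiv.mulLeft y) _ _ fun u ↦ ?_
    simp [map_mul]
  obtain ⟨x, hx⟩ := Finite.exists_max fun x ↦ form γ (f ∘ₗ (ρ x).toLinearMap)
  refine ⟨x, fun i ↦ ?_⟩
  let F := f ∘ₗ (ρ x).toLinearMap
  let b := M.simpleCoroot i
  have hrefl (a : Module.Dual ℝ (B → ℝ)) :
      a ∘ₗ (ρ (cs.simple i)).toLinearMap = a - a (Pi.single i 1) • b := by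
    refine LinearMap.ext fun v ↦ ?_
    simp [ρ, b, geometricRep_simple, CoxeterMatrix.simpleReflection_apply, mul_comm]
  have hb : b (Pi.single i 1) = 2 := M.simpleCoroot_single_self i
  have form_sub (a c d : Module.Dual ℝ (B → ℝ)) : form (a - c) d = form a d - form c d := by
    simp [form, sub_mul]
  have form_comm (a c : Module.Dual ℝ (B → ℝ)) : form a c = form c a := by
    simp [form, mul_comm]
  have form_smul (r : ℝ) (a c : Module.Dual ℝ (B → ℝ)) : form (r • a) c = r * form a c := by
    simp [form, Finset.mul_sum, mul_assoc]
  have hpos : 0 < form b b := by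
    refine Finset.sum_pos' (fun u _ ↦ Finset.sum_nonneg fun j _ ↦ mul_self_nonneg _)
      ⟨1, Finset.mem_univ _, Finset.sum_pos' (fun j _ ↦ mul_self_nonneg _)
        ⟨i, Finset.mem_univ _, ?_⟩⟩
    simp [hb]
  have hself : 2 * form b F = F (Pi.single i 1) * form b b := by
    have h := hinv b F (cs.simple i)
    rw [hrefl, hrefl, hb, form_sub, form_smul, form_comm b, form_sub, form_smul,
      form_comm F] at h
    linarith
  have hmax : form γ (F ∘ₗ (ρ (cs.simple i)).toLinearMap) ≤ form γ F := by
    have h := hx (x * cs.simple i)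
    rwa [map_mul, LinearEquiv.coe_toLinearMap_mul, Module.End.mul_eq_comp,
      ← LinearMap.comp_assoc] at h
  rw [← hinv γ _ (cs.simple i), LinearMap.comp_assoc] at hmax
  have hsq : (ρ (cs.simple i)).toLinearMap ∘ₗ (ρ (cs.simple i)).toLinearMap =
      LinearMap.id := by
    refine LinearMap.ext fun v ↦ ?_
    simp only [LinearMap.comp_apply, LinearEquiv.coe_coe, LinearMap.id_apply]
    rw [← LinearEquiv.mul_apply, ← map_mul, simple_mul_simple_self, map_one]
    rfl
  rw [hsq, LinearMap.comp_id, hrefl, hγ, one_smul, form_sub] at hmax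
  have : 0 ≤ F (Pi.single i 1) := by
    by_contra! hlt
    have := mul_neg_of_neg_of_pos hlt hpos
    linarith
  exact this

lemma le_of_wordProd_alternatingWord_eq
    (hM : ∀ i j, M i j = 1 ∨ M i j = 2 ∨ M i j = 3 ∨ M i j = 4 ∨ M i j = 6)
    {i j : B} (hij : i ≠ j) {m : ℕ} (hm : m ≠ 0)
    (h : cs.wordProd (alternatingWord i j m) = cs.wordProd (alternatingWord j i m)) :
    M i j ≤ m := by
  by_contra! hlt
  obtain ⟨m, rfl⟩ := Nat.exists_eq_succ_of_ne_zero hm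
  obtain ⟨a, b, ha, hb, hab⟩ := cs.geometricRep_alternatingWord_mem_span_nonneg hM hij hlt
  obtain ⟨c, d, hc, hd, hcd⟩ := cs.geometricRep_alternatingWord_mem_span_nonneg hM hij
    (m.lt_succ_self.trans hlt)
  rw [h, alternatingWord_succ, wordProd_concat, map_mul, LinearEquiv.mul_apply,
    geometricRep_simple_single, M.cartanEntry_self, map_sub, map_smul] at hab
  have hi := congrFun hab i
  have hj := congrFun hab j
  have hi' := congrFun hcd i
  have hj' := congrFun hcd j
  simp [hij, hij.symm] at hi hj hi' hj'
  have hc0 : c = 0 := by linarith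
  have hd0 : d = 0 := by linarith
  rw [hc0, hd0, zero_smul, zero_smul, add_zero, LinearEquiv.map_eq_zero_iff] at hcd
  simpa using congrFun hcd i

lemma map_wordProd (ε : MulAut W) (σ : B ≃ B) (hσ : ∀ i, ε (cs.simple i) = cs.simple (σ i))
    (ω : List B) : ε (cs.wordProd ω) = cs.wordProd (ω.map σ) := by
  induction ω with
  | nil => simp
  | cons i ω ih => simp [wordProd_cons, ih, hσ]

lemma map_alternatingWord (σ : B ≃ B) (i j : B) (m : ℕ) :
    (alternatingWord i j m).map σ = alternatingWord (σ i) (σ j) m := by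
  induction m generalizing i j with
  | zero => simp [alternatingWord]
  | succ m ih => simp [alternatingWord, ih]

lemma coxeterMatrix_apply_le
    (hM : ∀ i j, M i j = 1 ∨ M i j = 2 ∨ M i j = 3 ∨ M i j = 4 ∨ M i j = 6)
    (ε : MulAut W) (σ : B ≃ B)
    (hσ : ∀ i, ε (cs.simple i) = cs.simple (σ i)) (i j : B) :
    M (σ i) (σ j) ≤ M i j := by
  by_cases hij : i = j
  · simp [hij]
  · refine cs.le_of_wordProd_alternatingWord_eq hM (σ.injective.ne hij)
      (by rcases hM i j with h | h | h | h | h <;> omega) ?_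
    have h := congrArg ε (cs.wordProd_braidWord_eq i j)
    rw [map_wordProd cs ε σ hσ, map_wordProd cs ε σ hσ, braidWord, braidWord,
      map_alternatingWord, map_alternatingWord, M.symmetric j i] at h
    exact h

lemma coxeterMatrix_apply_eq
    (hM : ∀ i j, M i j = 1 ∨ M i j = 2 ∨ M i j = 3 ∨ M i j = 4 ∨ M i j = 6)
    (ε : MulAut W) (σ : B ≃ B)
    (hσ : ∀ i, ε (cs.simple i) = cs.simple (σ i)) (i j : B) :
    M (σ i) (σ j) = M i j := by
  refine le_antisymm (cs.coxeterMatrix_apply_le hM ε σ hσ i j) ?_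
  have h := cs.coxeterMatrix_apply_le hM ε.symm σ.symm
    (fun i ↦ by rw [MulEquiv.symm_apply_eq, hσ, Equiv.apply_symm_apply]) (σ i) (σ j)
  simpa using h

lemma geometricRep_map_apply (ε : MulAut W) (σ : B ≃ B)
    (hσ : ∀ i, ε (cs.simple i) = cs.simple (σ i)) (x : W) (v : B → ℝ) :
    cs.geometricRep hM (ε x) (v ∘ σ.symm) = cs.geometricRep hM x v ∘ σ.symm := by
  induction x using cs.simple_induction_left with
  | one => simp
  | mul_simple_left x i ih =>
    have hb (v : B → ℝ) : M.simpleCoroot (σ i) (v ∘ σ.symm) = M.simpleCoroot i v := by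
      simp only [CoxeterMatrix.simpleCoroot, Fintype.linearCombination_apply]
      refine Fintype.sum_equiv σ.symm _ _ fun j ↦ ?_
      have := cs.coxeterMatrix_apply_eq hM ε σ hσ i (σ.symm j)
      rw [Equiv.apply_symm_apply] at this
      simp [CoxeterMatrix.cartanEntry, this]
    rw [map_mul, map_mul, map_mul, LinearEquiv.mul_apply, LinearEquiv.mul_apply, ih, hσ,
      geometricRep_simple, geometricRep_simple, CoxeterMatrix.simpleReflection_apply,
      CoxeterMatrix.simpleReflection_apply, hb]
    ext j
    simp [Pi.single_apply, Equiv.symm_apply_eq]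

lemma det_geometricRep (w : W) :
    LinearMap.det (cs.geometricRep hM w).toLinearMap = (-1) ^ cs.length w := by
  obtain ⟨ω, hω, rfl⟩ := cs.exists_isReduced w
  rw [hω.eq]
  clear hω
  induction ω with
  | nil => simp
  | cons i ω ih =>
    have hr : (M.simpleReflection i).toLinearMap =
        LinearMap.transvection (-M.simpleCoroot i) (Pi.single i 1) := by
      refine LinearMap.ext fun v ↦ ?_
      simp [CoxeterMatrix.simpleReflection_apply, LinearMap.transvection.apply, sub_eq_add_neg]
    have hd : LinearMap.det (M.simpleReflection i).toLinearMap = -1 := by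
      rw [hr, LinearMap.transvection.det, LinearMap.neg_apply,
        CoxeterMatrix.simpleCoroot_single_self]
      norm_num
    rw [wordProd_cons, map_mul, LinearEquiv.coe_toLinearMap_mul, map_mul, ih,
      geometricRep_simple, hd, List.length_cons, pow_succ']

end CoxeterSystem

/-- A real matrix without eigenvalue `1` which preserves a nondegenerate bilinear form has
determinant `(-1) ^ n`. -/
lemma Matrix.det_eq_neg_one_pow_of_transpose_mul_mul_eq {A P : Matrix B B ℝ}
    (hA : (1 - A).det ≠ 0) (hP : P.det ≠ 0) (h : A.transpose * P * A = P) :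
    A.det = (-1) ^ Fintype.card B := by
  have h1 : A.transpose * P * (1 - A) = -(1 - A).transpose * P := by
    rw [mul_sub, h, mul_one, Matrix.transpose_sub, Matrix.transpose_one]
    noncomm_ring
  have h2 := congrArg Matrix.det h1
  rw [Matrix.det_mul, Matrix.det_mul, Matrix.det_mul, Matrix.det_neg, Matrix.det_transpose,
    Matrix.det_transpose] at h2
  exact mul_right_cancel₀ (mul_ne_zero hA hP) (by linear_combination h2)

end

/-- If `w ∈ W` is `D`-anisotropic (for every `x ∈ W` and every proper `ε`-stable subset `I ⊊ S`
one has `x·w·ε(x)⁻¹ ∉ W_I`), then `l(w) ≡ |S_ε| (mod 2)`, where `S_ε` is the set of `ε`-orbits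
on the set `S` of simple reflections (indexed here by `B`, with `ε` acting on `B` via `εB`).
Here `W` is a finite Weyl group (finite crystallographic Coxeter group) and `ε` is an
automorphism of `W` with `ε(S) = S`. -/
theorem stmt7
    {B : Type} [DecidableEq B] [Fintype B] {M : CoxeterMatrix B}
    (hM : ∀ i j, M i j = 1 ∨ M i j = 2 ∨ M i j = 3 ∨ M i j = 4 ∨ M i j = 6)
    {W : Type} [Group W] [Fintype W] (cs : CoxeterSystem M W)
    (ε : MulAut W) (εB : B ≃ B)
    (hεB : ∀ i, ε (cs.simple i) = cs.simple (εB i))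
    (w : W)
    (hw : ∀ (x : W) (I : Set B), I ≠ Set.univ → εB '' I = I →
      x * w * (ε x)⁻¹ ∉ Subgroup.closure (cs.simple '' I)) :
    cs.length w ≡ Nat.card (MulAction.orbitRel.Quotient (Subgroup.zpowers εB) B) [MOD 2] := by
  let ρ := cs.geometricRep hM
  let X : W → Matrix B B ℝ := fun x ↦ LinearMap.toMatrix' (ρ x).toLinearMap
  let E : Matrix B B ℝ := Equiv.Perm.permMatrix ℝ εB.symm
  have hX (x y : W) : X (x * y) = X x * X y := by
    simp only [X, map_mul, LinearEquiv.coe_toLinearMap_mul, LinearMap.toMatrix'_mul]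
  have hXv (x : W) (v : B → ℝ) : (X x).mulVec v = ρ x v := by
    simp [X, LinearMap.toMatrix'_mulVec]
  have hEv (v : B → ℝ) : E.mulVec v = v ∘ εB.symm := Matrix.permMatrix_mulVec _
  have hEX (x : W) : X (ε x) * E = E * X x := by
    refine Matrix.mulVec_injective (funext fun v ↦ ?_)
    rw [← Matrix.mulVec_mulVec, ← Matrix.mulVec_mulVec, hXv, hXv, hEv, hEv]
    exact cs.geometricRep_map_apply hM ε εB hεB x v
  have hfix : (1 - X w * E).det ≠ 0 := by
    intro h0
    obtain ⟨r, hr0, hr⟩ := Matrix.exists_vecMul_eq_zero_iff.2 h0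
    rw [Matrix.vecMul_sub, Matrix.vecMul_one, sub_eq_zero] at hr
    let f : Module.Dual ℝ (B → ℝ) := Fintype.linearCombination ℝ r
    have hfdot (v : B → ℝ) : f v = r ⬝ᵥ v := by
      simp [f, Fintype.linearCombination_apply, dotProduct, mul_comm]
    have hf (v : B → ℝ) : f (ρ w (v ∘ εB.symm)) = f v := by
      rw [← hEv, ← hXv, Matrix.mulVec_mulVec, hfdot, hfdot, Matrix.dotProduct_mulVec, ← hr]
    obtain ⟨x, hx⟩ := cs.exists_dominant hM f
    let g : Module.Dual ℝ (B → ℝ) := f ∘ₗ (ρ x).toLinearMap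
    let h : Module.Dual ℝ (B → ℝ) := g ∘ₗ LinearMap.funLeft ℝ ℝ εB
    have hsingle (i : B) : (Pi.single i 1 : B → ℝ) ∘ εB = Pi.single (εB.symm i) 1 := by
      ext j
      simp [Pi.single_apply, Equiv.eq_symm_apply]
    have hhi (i : B) : h (Pi.single i 1) = g (Pi.single (εB.symm i) 1) :=
      congrArg g (hsingle i)
    obtain ⟨hgh, hmem⟩ := cs.dominant_eq_and_mem_closure hM (x⁻¹ * w * ε x) g h hx
      (fun i ↦ hhi i ▸ hx _) fun v ↦ by
        change f (ρ x (ρ (x⁻¹ * w * ε x) v)) = f (ρ x (v ∘ εB))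
        rw [← LinearEquiv.mul_apply, ← map_mul, mul_assoc, mul_inv_cancel_left, map_mul,
          LinearEquiv.mul_apply, ← hf (ρ x (v ∘ εB)),
          ← cs.geometricRep_map_apply hM ε εB hεB x, Function.comp_assoc,
          Equiv.self_comp_symm, Function.comp_id]
    refine hw x⁻¹ {i | g (Pi.single i 1) = 0} (fun hI ↦ hr0 ?_) ?_ (by simpa using hmem)
    · have hg0 : g = 0 := by
        refine LinearMap.pi_ext' fun i ↦ LinearMap.ext_ring ?_
        exact (hI ▸ Set.mem_univ i : i ∈ {i | g (Pi.single i 1) = 0})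
      have hf0 (v : B → ℝ) : f v = 0 := by
        have := LinearMap.congr_fun hg0 ((ρ x).symm v)
        simpa [g] using this
      ext i
      simpa [f, Fintype.linearCombination_apply_single] using hf0 (Pi.single i 1)
    · ext i
      rw [Equiv.image_eq_preimage_symm, Set.mem_preimage, Set.mem_ofPred_eq, ← hhi, hgh,
        Set.mem_ofPred_eq]
  let P : Matrix B B ℝ := ∑ x, (X x).conjTranspose * X x
  have hP : P.det ≠ 0 := by
    refine (Matrix.posDef_sum Finset.univ_nonempty fun x _ ↦
      Matrix.PosDef.conjTranspose_mul_self _ fun v v' hv ↦ ?_).det_pos.ne'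
    rw [hXv, hXv] at hv
    exact (ρ x).injective hv
  have hEE : E.transpose * E = 1 := by
    simp only [E]
    rw [Matrix.transpose_permMatrix, ← Matrix.permMatrix_mul, mul_inv_cancel,
      Matrix.permMatrix_one]
  have hAP : (X w * E).transpose * P * (X w * E) = P := by
    simp only [P, Finset.mul_sum, Finset.sum_mul, Matrix.conjTranspose_eq_transpose_of_trivial]
    refine Fintype.sum_equiv ((Equiv.mulRight w).trans ε.symm.toEquiv) _ _ fun x ↦ ?_
    have hε : X (x * w) * E = E * X (ε.symm (x * w)) := by
      rw [← hEX, MulEquiv.apply_symm_apply]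
    calc (X w * E).transpose * ((X x).transpose * X x) * (X w * E)
        = (X (x * w) * E).transpose * (X (x * w) * E) := by
          simp only [hX, Matrix.transpose_mul, mul_assoc]
      _ = (X (ε.symm (x * w))).transpose * (E.transpose * E) * X (ε.symm (x * w)) := by
          rw [hε, Matrix.transpose_mul]
          simp only [mul_assoc]
      _ = _ := by
          rw [hEE, mul_one]
          rfl
  have hdet := Matrix.det_eq_neg_one_pow_of_transpose_mul_mul_eq hfix hP hAP
  have hdX : (X w).det = (-1) ^ cs.length w := by
    rw [LinearMap.det_toMatrix', cs.det_geometricRep]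
  simp only [E] at hdet
  rw [Matrix.det_mul, hdX, Matrix.det_permutation, Equiv.Perm.sign_symm] at hdet
  have hsign := Equiv.Perm.sign_eq_neg_one_pow_card_add_card_orbits εB
  rw [hsign] at hdet
  push_cast at hdet
  rw [pow_add, mul_comm ((-1 : ℝ) ^ Fintype.card B), ← mul_assoc] at hdet
  have hone := (mul_eq_right₀ (pow_ne_zero _ (by norm_num))).1 hdet
  rw [← pow_add, neg_one_pow_eq_one_iff_even (by norm_num), Nat.even_add'] at hone
  rw [Nat.ModEq]
  grind
end

section
/- Let V be the reflection representation of W over ℝ, with basis the simple roots {α_s}_{s∈S}, and let ε act ℝ-linearly on V by permuting this basis according to the action of ε on S. If w ∈ W is D-anisotropic, then det(w∘ε, V) = (−1)^{|S|}. -/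
/-- An isometry of a definite bilinear form without nonzero fixed vectors has
determinant `(-1) ^ n`. -/
theorem LinearMap.BilinForm.det_isometry_of_fixed_eq_zero {n : Type*} [Fintype n] [DecidableEq n]
    (b : LinearMap.BilinForm ℝ (n → ℝ)) (hb : ∀ v, b v v = 0 → v = 0)
    (φ : (n → ℝ) →ₗ[ℝ] (n → ℝ)) (hφ : ∀ x y, b (φ x) (φ y) = b x y)
    (hfix : ∀ v, φ v = v → v = 0) :
    LinearMap.det φ = (-1) ^ Fintype.card n := by
  set G : Matrix n n ℝ := LinearMap.toMatrix₂' ℝ b with hG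
  set A : Matrix n n ℝ := LinearMap.toMatrix' φ with hA
  have hAG : A.transpose * G * A = G := by
    rw [hG, hA, ← LinearMap.toMatrix₂'_compl₁₂]
    congr 1
    ext x y
    simp [hφ]
  have hGdet : G.det ≠ 0 := by
    intro h
    obtain ⟨v, hv, hGv⟩ := Matrix.exists_mulVec_eq_zero_iff.mpr h
    apply hv
    apply hb
    rw [← Matrix.toLinearMap₂'_toMatrix' (R := ℝ) b, Matrix.toLinearMap₂'_apply', ← hG, hGv,
      dotProduct_zero]
  have hAdet : (A - 1).det ≠ 0 := by
    intro h
    obtain ⟨v, hv, hAv⟩ := Matrix.exists_mulVec_eq_zero_iff.mpr h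
    apply hv
    apply hfix
    rw [Matrix.sub_mulVec, Matrix.one_mulVec, sub_eq_zero, hA, LinearMap.toMatrix'_mulVec] at hAv
    exact hAv
  have key : (A - 1).transpose * G * A = G * -(A - 1) := by
    rw [Matrix.transpose_sub, Matrix.sub_mul, Matrix.sub_mul, hAG, Matrix.transpose_one,
      Matrix.one_mul, neg_sub, Matrix.mul_sub, Matrix.mul_one]
  have hdet := congrArg Matrix.det key
  rw [Matrix.det_mul, Matrix.det_mul, Matrix.det_mul, Matrix.det_transpose, Matrix.det_neg] at hdet
  rw [← LinearMap.det_toMatrix', ← hA]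
  apply mul_left_cancel₀ (mul_ne_zero hAdet hGdet)
  rw [hdet]
  ring

namespace Representation

variable {B W : Type*} [Fintype B] [Group W] [Fintype W]

/-- The average over `W` of the standard bilinear form on `B → ℝ`. -/
noncomputable def averagedForm (ρ : Representation ℝ W (B → ℝ)) :
    LinearMap.BilinForm ℝ (B → ℝ) :=
  ∑ g : W, (dotProductBilin ℝ ℝ).compl₁₂ (ρ g) (ρ g)

theorem averagedForm_apply (ρ : Representation ℝ W (B → ℝ)) (x y : B → ℝ) :
    ρ.averagedForm x y = ∑ g : W, ρ g x ⬝ᵥ ρ g y := by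
  simp [averagedForm, LinearMap.sum_apply]

theorem averagedForm_invariant (ρ : Representation ℝ W (B → ℝ)) (g : W) (x y : B → ℝ) :
    ρ.averagedForm (ρ g x) (ρ g y) = ρ.averagedForm x y := by
  simp only [averagedForm_apply]
  refine Fintype.sum_equiv (Equiv.mulRight g) _ _ fun h => ?_
  simp [map_mul]

theorem averagedForm_self_nonneg (ρ : Representation ℝ W (B → ℝ)) (x : B → ℝ) :
    0 ≤ ρ.averagedForm x x := by
  rw [averagedForm_apply]
  exact Finset.sum_nonneg fun g _ => Finset.sum_nonneg fun i _ => mul_self_nonneg _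

theorem eq_zero_of_averagedForm_self (ρ : Representation ℝ W (B → ℝ)) (x : B → ℝ)
    (hx : ρ.averagedForm x x = 0) : x = 0 := by
  have hnonneg : ∀ g ∈ Finset.univ, 0 ≤ ρ g x ⬝ᵥ ρ g x :=
    fun g _ => Finset.sum_nonneg fun i _ => mul_self_nonneg _
  rw [averagedForm_apply, Finset.sum_eq_zero_iff_of_nonneg hnonneg] at hx
  simpa using hx 1 (Finset.mem_univ 1)

/-- The averaged form is preserved by a permutation of the coordinates that intertwines `ρ`
with its twist by an automorphism of `W`. -/
theorem averagedForm_funLeft (ρ : Representation ℝ W (B → ℝ)) (ε : MulAut W) (e : B ≃ B)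
    (h : ∀ g v, LinearMap.funLeft ℝ ℝ e (ρ g v) = ρ (ε g) (LinearMap.funLeft ℝ ℝ e v))
    (x y : B → ℝ) :
    ρ.averagedForm (LinearMap.funLeft ℝ ℝ e x) (LinearMap.funLeft ℝ ℝ e y) =
      ρ.averagedForm x y := by
  simp only [averagedForm_apply]
  symm
  refine Fintype.sum_equiv ε.toEquiv _ _ fun g => ?_
  change _ = ρ (ε g) _ ⬝ᵥ ρ (ε g) _
  rw [← h, ← h]
  exact (comp_equiv_dotProduct_comp_equiv (ρ g x) (ρ g y) e).symm

end Representation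

theorem CoxeterMatrix.sin_pi_div_pos {B : Type*} {M : CoxeterMatrix B} (hM : ∀ i j, M i j ≠ 0)
    {i j : B} (hij : i ≠ j) : 0 < Real.sin (Real.pi / M i j) := by
  have h2 : 2 ≤ M i j := by
    have := hM i j
    have := M.off_diagonal i j hij
    lia
  have h2' : (2 : ℝ) ≤ M i j := by exact_mod_cast h2
  apply Real.sin_pos_of_pos_of_lt_pi
  · exact div_pos Real.pi_pos (by linarith)
  · exact div_lt_self Real.pi_pos (by linarith)

namespace CoxeterSystem

variable {B : Type*} [DecidableEq B] {M : CoxeterMatrix B} {W : Type*} [Group W]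

/-- `ρ` is the geometric representation of the Coxeter system `cs`, with the standard basis as
the simple roots. -/
def IsGeometric (cs : CoxeterSystem M W) (ρ : Representation ℝ W (B → ℝ)) : Prop :=
  ∀ i j : B, ρ (cs.simple i) (Pi.single j 1 : B → ℝ) =
    (Pi.single j 1 : B → ℝ) + (2 * Real.cos (Real.pi / (M i j : ℝ))) • (Pi.single i 1 : B → ℝ)

variable {cs : CoxeterSystem M W} {ρ : Representation ℝ W (B → ℝ)}

namespace IsGeometric

theorem simple_apply_self (hρ : cs.IsGeometric ρ) (i : B) :
    ρ (cs.simple i) (Pi.single i 1 : B → ℝ) = -(Pi.single i 1 : B → ℝ) := by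
  rw [hρ i i, M.diagonal]
  simp only [Nat.cast_one, div_one, Real.cos_pi]
  module

theorem simple_apply [Fintype B] (hρ : cs.IsGeometric ρ) (i : B) (v : B → ℝ) :
    ρ (cs.simple i) v =
      v + (∑ j, v j * (2 * Real.cos (Real.pi / (M i j : ℝ)))) • (Pi.single i 1 : B → ℝ) := by
  conv_lhs => rw [pi_eq_sum_univ' v, map_sum]
  conv_rhs => enter [1]; rw [pi_eq_sum_univ' v]
  rw [Finset.sum_smul, ← Finset.sum_add_distrib]
  refine Finset.sum_congr rfl fun j _ => ?_
  simp only [map_smul, hρ i j, smul_add, smul_smul]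

theorem sin_smul_alternatingWord (hρ : cs.IsGeometric ρ) (i j : B) (k : ℕ) :
    Real.sin (Real.pi / M i j) •
        ρ (cs.wordProd (alternatingWord i j k)) (Pi.single i 1 : B → ℝ) =
      Real.sin ((k + 1) * (Real.pi / M i j)) • (Pi.single (if Even k then i else j) 1 : B → ℝ) +
      Real.sin (k * (Real.pi / M i j)) • (Pi.single (if Even k then j else i) 1 : B → ℝ) := by
  induction k with
  | zero => simp [alternatingWord]
  | succ k ih =>
    set θ := Real.pi / (M i j : ℝ) with hθ
    have hsin : Real.sin ((k + 1 + 1) * θ) =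
        2 * Real.cos θ * Real.sin ((k + 1) * θ) - Real.sin (k * θ) := by
      have e1 : ((k : ℝ) + 1 + 1) * θ = (k + 1) * θ + θ := by ring
      have e2 : (k : ℝ) * θ = (k + 1) * θ - θ := by ring
      rw [e1, e2, Real.sin_add, Real.sin_sub]
      ring
    rw [alternatingWord_succ', wordProd_cons, map_mul, Module.End.mul_apply, ← map_smul, ih,
      map_add, map_smul, map_smul]
    push_cast
    rw [hsin]
    by_cases hk : Even k
    · have hk' : ¬ Even (k + 1) := by simpa [Nat.even_add_one] using hk
      simp only [hk, hk', if_true, if_false, hρ.simple_apply_self, hρ j i, M.symmetric j i, ← hθ]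
      module
    · have hk' : Even (k + 1) := by simpa [Nat.even_add_one] using hk
      simp only [hk, hk', if_true, if_false, hρ.simple_apply_self, hρ i j, ← hθ]
      module

theorem dvd_of_simple_mul_simple_pow_eq_one (hρ : cs.IsGeometric ρ) (hM : ∀ i j, M i j ≠ 0)
    (i j : B) (p : ℕ) (hp : (cs.simple i * cs.simple j) ^ p = 1) : M i j ∣ p := by
  by_cases hij : i = j
  · simp [hij]
  have hword : cs.wordProd (alternatingWord i j (2 * p)) = 1 := by
    rw [prod_alternatingWord_eq_mul_pow]
    simp [hp]
  have h := hρ.sin_smul_alternatingWord i j (2 * p)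
  rw [hword] at h
  have hpos := CoxeterMatrix.sin_pi_div_pos hM hij
  simp only [map_one, Module.End.one_apply, even_two, Even.mul_right, if_true] at h
  have hi := congrFun h i
  have hj := congrFun h j
  simp only [Pi.smul_apply, Pi.add_apply, Pi.single_eq_same, Pi.single_eq_of_ne hij,
    Pi.single_eq_of_ne (Ne.symm hij), smul_eq_mul, mul_one, mul_zero, add_zero, zero_add] at hi hj
  rw [add_mul, one_mul, Real.sin_add, ← hj, zero_mul, zero_add] at hi
  have hcos : Real.cos (((2 * p : ℕ) : ℝ) * (Real.pi / M i j)) = 1 := by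
    apply mul_right_cancel₀ hpos.ne'
    rw [one_mul, ← hi]
  obtain ⟨n, hn⟩ := (Real.cos_eq_one_iff _).mp hcos
  have hM0 : (M i j : ℝ) ≠ 0 := by exact_mod_cast hM i j
  have hn' : (n : ℝ) * M i j = p := by
    have hpi := Real.pi_ne_zero
    push_cast at hn
    field_simp at hn
    linarith
  have hnp : (p : ℤ) = M i j * n := by
    have : n * (M i j : ℤ) = p := by exact_mod_cast hn'
    rw [← this, mul_comm]
  exact Int.natCast_dvd_natCast.mp ⟨n, hnp⟩

theorem apply_single_nonneg (hρ : cs.IsGeometric ρ) (hM : ∀ i j, M i j ≠ 0) (w : W) (i : B)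
    (hw : cs.length w < cs.length (w * cs.simple i)) : 0 ≤ ρ w (Pi.single i 1 : B → ℝ) := by
  induction hn : cs.length w using Nat.strong_induction_on generalizing w i with
  | _ n ih =>
  subst hn
  by_cases h1 : w = 1
  · subst h1
    simp [Pi.single_nonneg]
  obtain ⟨j, hj⟩ := cs.exists_rightDescent_of_ne_one h1
  have hij : i ≠ j := by
    rintro rfl
    exact lt_asymm hw hj
  let P : ℕ → Prop := fun k =>
    ∃ v, w = v * cs.wordProd (alternatingWord i j k) ∧ cs.length w = cs.length v + k
  have hP1 : P 1 := by
    refine ⟨w * cs.simple j, ?_, ?_⟩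
    · simp [alternatingWord]
    · exact (cs.isRightDescent_iff.mp hj).symm
  have hw1 : 1 ≤ cs.length w := by
    have := hj
    unfold IsRightDescent at this
    lia
  classical
  obtain ⟨k, hk1, hkP, hkmax⟩ : ∃ k, 1 ≤ k ∧ P k ∧ ¬ P (k + 1) := by
    refine ⟨Nat.findGreatest P (cs.length w), Nat.le_findGreatest hw1 hP1,
      Nat.findGreatest_spec hw1 hP1, fun h => ?_⟩
    have hle : Nat.findGreatest P (cs.length w) + 1 ≤ cs.length w := by
      obtain ⟨v, -, hv⟩ := h
      lia
    have := Nat.le_findGreatest hle h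
    lia
  obtain ⟨v, hwv, hlen⟩ := hkP
  have hkM : k < M i j := by
    by_contra! hle
    have hnr := cs.not_isReduced_alternatingWord j i (m := k + 1) (hM j i)
      (by rw [M.symmetric j i]; lia)
    have h2 : cs.length (cs.wordProd (alternatingWord j i (k + 1))) < k + 1 := by
      refine lt_of_le_of_ne ?_ ?_
      · simpa using cs.length_wordProd_le (alternatingWord j i (k + 1))
      · simpa [IsReduced] using hnr
    have h3 : w * cs.simple i = v * cs.wordProd (alternatingWord j i (k + 1)) := by
      rw [alternatingWord_succ, wordProd_concat, hwv, mul_assoc]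
    have h4 := cs.length_mul_le v (cs.wordProd (alternatingWord j i (k + 1)))
    rw [← h3] at h4
    lia
  have hnext : cs.length v < cs.length (v * cs.simple (if Even k then j else i)) := by
    by_contra! hle
    apply hkmax
    refine ⟨v * cs.simple (if Even k then j else i), ?_, ?_⟩
    · rw [alternatingWord_succ', wordProd_cons, ← mul_assoc, simple_mul_simple_cancel_right, hwv]
    · have := cs.length_mul_simple v (if Even k then j else i)
      lia
  have hfirst : cs.length v < cs.length (v * cs.simple (if Even k then i else j)) := by
    by_contra! hle
    obtain ⟨l, rfl⟩ : ∃ l, k = l + 1 := ⟨k - 1, by lia⟩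
    have h3 : w = v * cs.simple (if Even (l + 1) then i else j) *
        cs.wordProd (alternatingWord i j l) := by
      rw [hwv, alternatingWord_succ', wordProd_cons, mul_assoc]
      by_cases hl : Even l
      · simp [hl, Nat.even_add_one]
      · simp [hl, Nat.even_add_one]
    have h4 := cs.length_mul_le (v * cs.simple (if Even (l + 1) then i else j))
      (cs.wordProd (alternatingWord i j l))
    rw [← h3] at h4
    have h5 := cs.length_wordProd_le (alternatingWord i j l)
    rw [length_alternatingWord] at h5
    have := cs.length_mul_simple v (if Even (l + 1) then i else j)
    lia
  have hpos1 := ih (cs.length v) (by lia) v _ hfirst rfl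
  have hpos2 := ih (cs.length v) (by lia) v _ hnext rfl
  have hsin := CoxeterMatrix.sin_pi_div_pos hM hij
  have hmain := congrArg (ρ v) (hρ.sin_smul_alternatingWord i j k)
  rw [map_smul, ← Module.End.mul_apply, ← map_mul, ← hwv, map_add, map_smul, map_smul] at hmain
  have hsin_nonneg : ∀ a : ℕ, a ≤ M i j → 0 ≤ Real.sin (a * (Real.pi / M i j)) := by
    intro a ha
    have hM0 : (0 : ℝ) < M i j := by exact_mod_cast Nat.pos_of_ne_zero (hM i j)
    have ha' : (a : ℝ) ≤ M i j := by exact_mod_cast ha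
    apply Real.sin_nonneg_of_nonneg_of_le_pi
    · have := Real.pi_pos
      positivity
    · rw [mul_div_assoc', div_le_iff₀ hM0, mul_comm]
      exact mul_le_mul_of_nonneg_left ha' Real.pi_pos.le
  have hs1 := hsin_nonneg (k + 1) hkM
  have hs0 := hsin_nonneg k hkM.le
  push_cast at hs1
  have hge := add_nonneg (smul_nonneg hs1 hpos1) (smul_nonneg hs0 hpos2)
  rw [← hmain] at hge
  exact (smul_nonneg_iff_nonneg_of_pos_left hsin).mp hge

theorem apply_single_nonpos (hρ : cs.IsGeometric ρ) (hM : ∀ i j, M i j ≠ 0) (w : W) (i : B)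
    (hw : cs.IsRightDescent w i) : ρ w (Pi.single i 1 : B → ℝ) ≤ 0 := by
  have h := hρ.apply_single_nonneg hM (w * cs.simple i) i
    (by rwa [simple_mul_simple_cancel_right])
  rw [map_mul, Module.End.mul_apply, hρ.simple_apply_self, map_neg] at h
  exact neg_nonneg.mp h

/-- The geometric representation intertwines diagram automorphisms. -/
theorem funLeft_apply [Fintype B] (hρ : cs.IsGeometric ρ) (hM : ∀ i j, M i j ≠ 0)
    (ε : MulAut W) (e : B ≃ B) (he : ∀ i, ε (cs.simple i) = cs.simple (e i)) (w : W)
    (v : B → ℝ) :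
    LinearMap.funLeft ℝ ℝ e.symm (ρ w v) = ρ (ε w) (LinearMap.funLeft ℝ ℝ e.symm v) := by
  have hsymm : ∀ i j, M (e i) (e j) = M i j := by
    intro i j
    apply Nat.dvd_antisymm
    · apply hρ.dvd_of_simple_mul_simple_pow_eq_one hM
      rw [← he, ← he, ← map_mul, ← map_pow, cs.simple_mul_simple_pow, map_one]
    · apply hρ.dvd_of_simple_mul_simple_pow_eq_one hM
      apply ε.injective
      rw [map_pow, map_mul, he, he, cs.simple_mul_simple_pow, map_one]
  have hsingle : ∀ i, LinearMap.funLeft ℝ ℝ e.symm (Pi.single i 1 : B → ℝ) =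
      Pi.single (e i) 1 := by
    intro i
    ext k
    simp [LinearMap.funLeft_apply, Pi.single_apply, Equiv.symm_apply_eq]
  induction w using cs.simple_induction generalizing v with
  | simple i =>
    rw [he, hρ.simple_apply, hρ.simple_apply, map_add, map_smul, hsingle]
    congr 2
    refine Fintype.sum_equiv e _ _ fun j => ?_
    simp [LinearMap.funLeft_apply, hsymm]
  | one => simp
  | mul w w' hw hw' => simp only [map_mul, Module.End.mul_apply, hw, hw']

section averagedForm

variable [Fintype B] [Fintype W]

theorem averagedForm_single (hρ : cs.IsGeometric ρ) (v : B → ℝ) (i : B) :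
    2 * ρ.averagedForm v (Pi.single i 1) =
      -(∑ j, v j * (2 * Real.cos (Real.pi / (M i j : ℝ)))) *
        ρ.averagedForm (Pi.single i 1) (Pi.single i 1) := by
  have h := ρ.averagedForm_invariant (cs.simple i) v (Pi.single i 1)
  rw [hρ.simple_apply_self, hρ.simple_apply] at h
  simp only [map_add, map_neg, map_smul, LinearMap.add_apply, LinearMap.smul_apply,
    smul_eq_mul] at h
  linarith

theorem averagedForm_single_self_pos (ρ : Representation ℝ W (B → ℝ)) (i : B) :
    0 < ρ.averagedForm (Pi.single i 1) (Pi.single i 1) := by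
  refine lt_of_le_of_ne (ρ.averagedForm_self_nonneg _) fun h => ?_
  have := congrFun (ρ.eq_zero_of_averagedForm_self _ h.symm) i
  simp at this

theorem simple_apply_of_averagedForm_eq_zero (hρ : cs.IsGeometric ρ) (v : B → ℝ) (i : B)
    (h : ρ.averagedForm v (Pi.single i 1) = 0) : ρ (cs.simple i) v = v := by
  have h2 := hρ.averagedForm_single v i
  rw [h, mul_zero, eq_comm, mul_eq_zero, neg_eq_zero] at h2
  rw [hρ.simple_apply, h2.resolve_right (averagedForm_single_self_pos ρ i).ne', zero_smul,
    add_zero]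

/-- Every vector is conjugate to a dominant one. -/
theorem exists_dominant (hρ : cs.IsGeometric ρ) (v : B → ℝ) :
    ∃ x : W, ∀ i, 0 ≤ ρ.averagedForm (ρ x v) (Pi.single i 1) := by
  obtain ⟨x, hx⟩ := Finite.exists_max fun x : W => ∑ j, ρ x v j
  refine ⟨x, fun i => ?_⟩
  have h := hx (cs.simple i * x)
  rw [map_mul, Module.End.mul_apply, hρ.simple_apply] at h
  simp only [Pi.add_apply, Pi.smul_apply, Finset.sum_add_distrib, smul_eq_mul, ← Finset.mul_sum,
    Finset.sum_pi_single', Finset.mem_univ, if_true, mul_one, add_le_iff_nonpos_right] at h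
  have h2 := hρ.averagedForm_single (ρ x v) i
  have h3 := averagedForm_single_self_pos ρ i
  have h4 := mul_nonneg (neg_nonneg.mpr h) h3.le
  linarith

theorem averagedForm_nonneg (v u : B → ℝ)
    (hv : ∀ i, 0 ≤ ρ.averagedForm v (Pi.single i 1)) (hu : 0 ≤ u) :
    0 ≤ ρ.averagedForm v u := by
  rw [pi_eq_sum_univ' u, map_sum]
  refine Finset.sum_nonneg fun j _ => ?_
  rw [map_smul, smul_eq_mul]
  exact mul_nonneg (hu j) (hv j)

/-- Conjugate dominant vectors are equal, and the conjugating element lies in the parabolic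
subgroup generated by the simple reflections orthogonal to them. -/
theorem dominant_unique (hρ : cs.IsGeometric ρ) (hM : ∀ i j, M i j ≠ 0) (v : B → ℝ) (w : W)
    (hv : ∀ i, 0 ≤ ρ.averagedForm v (Pi.single i 1))
    (hwv : ∀ i, 0 ≤ ρ.averagedForm (ρ w v) (Pi.single i 1)) :
    ρ w v = v ∧
      w ∈ Subgroup.closure (cs.simple '' {i | ρ.averagedForm v (Pi.single i 1) = 0}) := by
  induction hn : cs.length w using Nat.strong_induction_on generalizing w with
  | _ n ih =>
  subst hn
  by_cases h1 : w = 1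
  · subst h1
    exact ⟨by simp, one_mem _⟩
  obtain ⟨i, hi⟩ := cs.exists_rightDescent_of_ne_one h1
  have hneg := hρ.apply_single_nonpos hM w i hi
  have h2 := averagedForm_nonneg (ρ := ρ) (ρ w v) _ hwv (neg_nonneg.mpr hneg)
  rw [map_neg, ρ.averagedForm_invariant] at h2
  have h0 : ρ.averagedForm v (Pi.single i 1) = 0 := le_antisymm (neg_nonneg.mp h2) (hv i)
  have hfix := hρ.simple_apply_of_averagedForm_eq_zero v i h0
  have hws : ρ (w * cs.simple i) v = ρ w v := by
    rw [map_mul, Module.End.mul_apply, hfix]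
  obtain ⟨h3, h4⟩ := ih _ hi (w * cs.simple i) (by rwa [hws]) rfl
  refine ⟨hws ▸ h3, ?_⟩
  have h5 := mul_mem h4 (Subgroup.subset_closure (Set.mem_image_of_mem cs.simple h0))
  rwa [simple_mul_simple_cancel_right] at h5

end averagedForm

end IsGeometric

end CoxeterSystem


/-- Let `V = B → ℝ` be the reflection (geometric) representation of the finite Weyl group `W`,
with basis the simple roots `{α_i}` (the standard basis vectors `Pi.single i 1`), on which the
simple reflection `s_i` acts by `α_j ↦ α_j + 2·cos(π/m_{ij})·α_i`, and let `ε` act `ℝ`-linearly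
on `V` by permuting this basis according to its action `εB` on the simple reflections.  If
`w ∈ W` is `D`-anisotropic, then `det(w ∘ ε, V) = (−1)^{|S|}`. -/
theorem stmt8
    {B : Type} [DecidableEq B] [Fintype B] {M : CoxeterMatrix B}
    (hM : ∀ i j, M i j = 1 ∨ M i j = 2 ∨ M i j = 3 ∨ M i j = 4 ∨ M i j = 6)
    {W : Type} [Group W] [Fintype W] (cs : CoxeterSystem M W)
    (ε : MulAut W) (εB : B ≃ B)
    (hεB : ∀ i, ε (cs.simple i) = cs.simple (εB i))
    (ρ : Representation ℝ W (B → ℝ))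
    (hρ : ∀ i j : B, ρ (cs.simple i) (Pi.single j 1 : B → ℝ) =
      (Pi.single j 1 : B → ℝ) + (2 * Real.cos (Real.pi / (M i j : ℝ))) • (Pi.single i 1 : B → ℝ))
    (w : W)
    (hw : ∀ (x : W) (I : Set B), I ≠ Set.univ → εB '' I = I →
      x * w * (ε x)⁻¹ ∉ Subgroup.closure (cs.simple '' I)) :
    LinearMap.det ((ρ w) ∘ₗ LinearMap.funLeft ℝ ℝ ⇑εB.symm) = (-1) ^ Fintype.card B := by
  have hM0 : ∀ i j, M i j ≠ 0 := by
    intro i j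
    have := hM i j
    lia
  replace hρ : cs.IsGeometric ρ := hρ
  have hE := hρ.funLeft_apply hM0 ε εB hεB
  have hEb := ρ.averagedForm_funLeft ε εB.symm hE
  have hsingle : ∀ i, LinearMap.funLeft ℝ ℝ εB.symm (Pi.single i 1 : B → ℝ) =
      Pi.single (εB i) 1 := by
    intro i
    ext k
    simp [LinearMap.funLeft_apply, Pi.single_apply, Equiv.symm_apply_eq]
  set E := LinearMap.funLeft ℝ ℝ εB.symm
  refine ρ.averagedForm.det_isometry_of_fixed_eq_zero ρ.eq_zero_of_averagedForm_self _
    (fun x y => ?_) fun v hv => ?_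
  · simp only [LinearMap.comp_apply, ρ.averagedForm_invariant, hEb]
  by_contra hv0
  obtain ⟨x, hx⟩ := hρ.exists_dominant v
  set u := ρ x v with hu
  have hEu : ∀ i, ρ.averagedForm (E u) (Pi.single (εB i) 1) =
      ρ.averagedForm u (Pi.single i 1) := by
    intro i
    rw [← hsingle, hEb]
  have hfix : ρ (x * w * (ε x)⁻¹) (E u) = u := by
    rw [hu, hE, ← Module.End.mul_apply, ← map_mul, inv_mul_cancel_right, map_mul,
      Module.End.mul_apply]
    exact congrArg (ρ x) hv
  have hEu0 : ∀ i, 0 ≤ ρ.averagedForm (E u) (Pi.single i 1) := by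
    intro i
    have := hEu (εB.symm i)
    rw [Equiv.apply_symm_apply] at this
    rw [this]
    exact hx _
  obtain ⟨h1, h2⟩ := hρ.dominant_unique hM0 (E u) (x * w * (ε x)⁻¹) hEu0 (by rwa [hfix])
  have hEuu : E u = u := by rw [← h1, hfix]
  rw [hEuu] at h2 hEu
  refine hw x _ ?_ ?_ h2
  · intro huniv
    have hall : ∀ i, ρ.averagedForm u (Pi.single i 1) = 0 := fun i =>
      Set.eq_univ_iff_forall.mp huniv i
    have huu : u = 0 := by
      apply ρ.eq_zero_of_averagedForm_self
      have hzero : ρ.averagedForm u = 0 := by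
        refine LinearMap.pi_ext' fun i => LinearMap.ext_ring ?_
        simpa using hall i
      rw [hzero, LinearMap.zero_apply]
    apply hv0
    have := congrArg (ρ x⁻¹) huu
    rwa [hu, ← Module.End.mul_apply, ← map_mul, inv_mul_cancel, map_one, Module.End.one_apply,
      map_zero] at this
  · ext i
    rw [Equiv.image_eq_preimage_symm, Set.mem_preimage, Set.mem_ofPred_eq, Set.mem_ofPred_eq, ← hEu,
      Equiv.apply_symm_apply]
end

section
/- An element w ∈ S_n is D-anisotropic if and only if the permutation w·w₀ has odd order in S_n. -/
/-- If `orderOf u` is even, some point is not fixed by any odd power of `u`. -/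
theorem exists_forall_odd_pow_apply_ne {α : Type*} [Fintype α] (u : Equiv.Perm α)
    (hu : ¬ Odd (orderOf u)) : ∃ x, ∀ N : ℕ, Odd N → (u ^ N) x ≠ x := by
  by_contra! h
  choose N hodd hN using h
  apply hu
  have hprod : u ^ (∏ x, N x) = 1 := by
    ext1 y
    obtain ⟨c, hc⟩ := Finset.dvd_prod_of_mem N (Finset.mem_univ y)
    rw [hc, pow_mul, Equiv.Perm.one_apply]
    exact Function.IsFixedPt.perm_pow (hN y) c
  exact (Finset.prod_induction N Odd (fun _ _ => Odd.mul) odd_one fun x _ => hodd x).of_dvd_nat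
    (orderOf_dvd_of_pow_eq_one hprod)

/-- A permutation of even order interchanges two disjoint nonempty sets. -/
theorem exists_disjoint_interchanged {α : Type*} [Fintype α] (u : Equiv.Perm α)
    (hu : ¬ Odd (orderOf u)) :
    ∃ A B : Set α, A.Nonempty ∧ Disjoint A B ∧ (∀ i, u i ∈ A ↔ i ∈ B) ∧ ∀ i, u i ∈ B ↔ i ∈ A := by
  obtain ⟨x, hx⟩ := exists_forall_odd_pow_apply_ne u hu
  have hx' : ∀ z : ℤ, Odd z → (u ^ z) x ≠ x := by
    intro z hz h
    refine hx z.natAbs (Int.natAbs_odd.mpr hz) ?_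
    rcases Int.natAbs_eq z with hz' | hz' <;> rw [hz'] at h
    · rwa [zpow_natCast] at h
    · rw [zpow_neg, Equiv.Perm.inv_eq_iff_eq, zpow_natCast] at h
      exact h.symm
  have hstep : ∀ (i : α) (z : ℤ), u i = (u ^ z) x ↔ i = (u ^ (z - 1)) x := by
    intro i z
    rw [sub_eq_neg_add, zpow_add, Equiv.Perm.mul_apply, zpow_neg_one, Equiv.Perm.eq_inv_iff_eq]
  refine ⟨{i | ∃ z : ℤ, Even z ∧ i = (u ^ z) x}, {i | ∃ z : ℤ, Odd z ∧ i = (u ^ z) x},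
    ⟨x, 0, Even.zero, by simp⟩, ?_, ?_, ?_⟩
  · rw [Set.disjoint_left]
    rintro _ ⟨z, hz, rfl⟩ ⟨t, ht, h⟩
    refine hx' (-z + t) (hz.neg.add_odd ht) ?_
    rw [zpow_add, Equiv.Perm.mul_apply, ← h, ← Equiv.Perm.mul_apply, ← zpow_add]
    simp
  · refine fun i => ⟨fun ⟨z, hz, h⟩ => ⟨z - 1, hz.sub_odd odd_one, (hstep i z).1 h⟩,
      fun ⟨z, hz, h⟩ => ⟨z + 1, hz.add_odd odd_one, (hstep i _).2 ?_⟩⟩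
    simpa using h
  · refine fun i => ⟨fun ⟨z, hz, h⟩ => ⟨z - 1, hz.sub_odd odd_one, (hstep i z).1 h⟩,
      fun ⟨z, hz, h⟩ => ⟨z + 1, hz.add_odd odd_one, (hstep i _).2 ?_⟩⟩
    simpa using h

/-- Two maps with equinumerous fibres differ by a permutation of their domain. -/
theorem exists_perm_comp_eq {α β : Type*} [Finite α] (c d : α → β)
    (h : ∀ b, Nat.card {a // c a = b} = Nat.card {a // d a = b}) :
    ∃ g : Equiv.Perm α, ∀ a, d (g a) = c a := by
  let e : ∀ b, {a // c a = b} ≃ {a // d a = b} := fun b => (Finite.card_eq.1 (h b)).some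
  refine ⟨((Equiv.sigmaFiberEquiv c).symm.trans
    (Equiv.sigmaCongrRight e)).trans
      (Equiv.sigmaFiberEquiv d), fun a => ?_⟩
  exact (e (c a) ⟨a, rfl⟩).2

/-- Two disjoint pairs of finite sets of equal sizes differ by a permutation. -/
theorem exists_perm_mem_iff {α : Type*} [Finite α] (A B A' B' : Set α) (hAB : Disjoint A B)
    (hAB' : Disjoint A' B') (hA : A.ncard = A'.ncard) (hB : B.ncard = B'.ncard) :
    ∃ g : Equiv.Perm α, (∀ a, g a ∈ A' ↔ a ∈ A) ∧ ∀ a, g a ∈ B' ↔ a ∈ B := by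
  classical
  let c : Set α → Set α → α → Option Bool := fun X Y a =>
    if a ∈ X then some true else if a ∈ Y then some false else none
  have htrue : ∀ X Y a, c X Y a = some true ↔ a ∈ X := by
    intro X Y a
    simp only [c]
    split_ifs <;> simp_all
  have hfalse : ∀ X Y, Disjoint X Y → ∀ a, c X Y a = some false ↔ a ∈ Y := by
    intro X Y hXY a
    have := fun ha : a ∈ X => Set.disjoint_left.1 hXY ha
    simp only [c]
    split_ifs <;> simp_all
  have hnone : ∀ X Y a, c X Y a = none ↔ a ∈ (X ∪ Y)ᶜ := by
    intro X Y a
    simp only [c]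
    split_ifs <;> simp_all
  obtain ⟨g, hg⟩ := exists_perm_comp_eq (c A B) (c A' B') (by
    rintro (_ | _ | _)
    · simp only [hnone]
      change (A ∪ B)ᶜ.ncard = (A' ∪ B')ᶜ.ncard
      rw [Set.ncard_compl, Set.ncard_compl, Set.ncard_union_eq hAB, Set.ncard_union_eq hAB', hA, hB]
    · simp only [hfalse _ _ hAB, hfalse _ _ hAB']
      exact hB
    · simp only [htrue]
      exact hA)
  exact ⟨g, fun a => by rw [← htrue A' B', hg, htrue],
    fun a => by rw [← hfalse _ _ hAB', hg, hfalse _ _ hAB]⟩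

/-- The permutations of `Fin n` that stabilize the initial segment of length `k`. -/
def initialStabilizer (n k : ℕ) : Subgroup (Equiv.Perm (Fin n)) where
  carrier := {s | ∀ i, (s i : ℕ) < k ↔ (i : ℕ) < k}
  one_mem' := fun _ => Iff.rfl
  mul_mem' := fun {s t} hs ht i => (hs (t i)).trans (ht i)
  inv_mem' := fun {s} hs i => by simpa using (hs (s⁻¹ i)).symm

theorem mem_initialStabilizer {n k : ℕ} {s : Equiv.Perm (Fin n)} :
    s ∈ initialStabilizer n k ↔ ∀ i, (s i : ℕ) < k ↔ (i : ℕ) < k := Iff.rfl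

theorem swap_mem_initialStabilizer {n k : ℕ} {a b : Fin n} (hab : (b : ℕ) = a + 1) :
    Equiv.swap a b ∈ initialStabilizer n k ↔ (b : ℕ) ≠ k := by
  rw [mem_initialStabilizer]
  constructor
  · rintro h rfl
    have := h a
    rw [Equiv.swap_apply_left] at this
    omega
  · intro h i
    rcases eq_or_ne i a with rfl | hia
    · rw [Equiv.swap_apply_left]; omega
    rcases eq_or_ne i b with rfl | hib
    · rw [Equiv.swap_apply_right]; omega
    rw [Equiv.swap_apply_of_ne_of_ne hia hib]

theorem revPerm_conj_mem_initialStabilizer {n k l : ℕ} (hkl : k + l = n)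
    {s : Equiv.Perm (Fin n)} (hs : s ∈ initialStabilizer n k) :
    Fin.revPerm * s * Fin.revPerm⁻¹ ∈ initialStabilizer n l := by
  rw [mem_initialStabilizer] at hs ⊢
  intro i
  have h := hs (Fin.rev i)
  have h1 : ((Fin.revPerm * s * Fin.revPerm⁻¹ : Equiv.Perm (Fin n)) i) = Fin.rev (s (Fin.rev i)) :=
    rfl
  rw [h1, Fin.val_rev]
  rw [Fin.val_rev] at h
  have := (s (Fin.rev i)).isLt
  have := i.isLt
  omega

/-- A permutation stabilizing two initial segments is a product of adjacent transpositions that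
do so. -/
theorem mem_closure_of_mem_initialStabilizer {n k l : ℕ} {y : Equiv.Perm (Fin n)}
    (hk : y ∈ initialStabilizer n k) (hl : y ∈ initialStabilizer n l) :
    y ∈ Subgroup.closure {s : Equiv.Perm (Fin n) |
      (∃ a b : Fin n, (b : ℕ) = (a : ℕ) + 1 ∧ s = Equiv.swap a b) ∧
        s ∈ initialStabilizer n k ∧ s ∈ initialStabilizer n l} := by
  set I := {s : Equiv.Perm (Fin n) |
      (∃ a b : Fin n, (b : ℕ) = (a : ℕ) + 1 ∧ s = Equiv.swap a b) ∧
        s ∈ initialStabilizer n k ∧ s ∈ initialStabilizer n l} with hI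
  have hup : ∀ (d : ℕ) (a b : Fin n), (b : ℕ) = a + d → ((b : ℕ) < k ↔ (a : ℕ) < k) →
      ((b : ℕ) < l ↔ (a : ℕ) < l) → b ∈ MulAction.orbit (Subgroup.closure I) a := by
    intro d
    induction d with
    | zero =>
      intro a b hab _ _
      obtain rfl : b = a := Fin.ext hab
      exact MulAction.mem_orbit_self b
    | succ d ih =>
      intro a b hab h1 h2
      let c : Fin n := ⟨a + d, by omega⟩
      have hcb : (b : ℕ) = c + 1 := by simp only [c]; omega
      have hc : c ∈ MulAction.orbit (Subgroup.closure I) a :=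
        ih a c rfl (by simp only [c]; omega) (by simp only [c]; omega)
      have hs : Equiv.swap c b ∈ Subgroup.closure I := by
        refine Subgroup.subset_closure ⟨⟨c, b, hcb, rfl⟩, ?_, ?_⟩ <;>
        · rw [swap_mem_initialStabilizer hcb]
          omega
      rw [← MulAction.orbit_eq_iff.2 hc]
      exact ⟨⟨_, hs⟩, Equiv.swap_apply_left c b⟩
  refine (mem_closure_isSwap ?_).2 ⟨Set.toFinite _, fun x => ?_⟩
  · rintro _ ⟨⟨a, b, hab, rfl⟩, -⟩
    exact ⟨a, b, fun h => by simp [h] at hab, rfl⟩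
  · rcases le_total (x : ℕ) (y x) with h | h
    · exact hup (y x - x) x (y x) (by omega) (hk x) (hl x)
    · exact MulAction.mem_orbit_symm.1
        (hup (x - y x) (y x) x (by omega) (hk x).symm (hl x).symm)

/-- A permutation that interchanges two disjoint sets, one of them nonempty, has even order. -/
theorem not_odd_orderOf_of_interchanges {α : Type*} {v : Equiv.Perm α} {A B : Set α}
    (hA : A.Nonempty) (hAB : Disjoint A B) (h1 : ∀ i ∈ A, v i ∈ B) (h2 : ∀ i ∈ B, v i ∈ A) :
    ¬ Odd (orderOf v) := by
  rintro ⟨m, hm⟩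
  obtain ⟨i, hi⟩ := hA
  have heven : ∀ m : ℕ, (v ^ (2 * m)) i ∈ A := by
    intro m
    induction m with
    | zero => simpa using hi
    | succ m ih =>
      rw [show 2 * (m + 1) = 2 * m + 1 + 1 by ring, pow_succ', pow_succ']
      exact h2 _ (h1 _ ih)
  have hB : (v ^ (2 * m + 1)) i ∈ B := by
    rw [pow_succ']
    exact h1 _ (heven m)
  rw [← hm, pow_orderOf_eq_one] at hB
  exact Set.disjoint_left.1 hAB hi hB

/-- A permutation of even order has a conjugate `v` such that `v * Fin.revPerm` stabilizes two
complementary initial segments. -/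
theorem exists_conj_mul_revPerm_mem {n : ℕ} (u : Equiv.Perm (Fin n)) (hu : ¬ Odd (orderOf u)) :
    ∃ (k l : ℕ) (g : Equiv.Perm (Fin n)), 0 < k ∧ 0 < l ∧ k + l = n ∧
      g * u * g⁻¹ * Fin.revPerm ∈ initialStabilizer n k ∧
      g * u * g⁻¹ * Fin.revPerm ∈ initialStabilizer n l := by
  obtain ⟨A, B, hA, hAB, h1, h2⟩ := exists_disjoint_interchanged u hu
  have hcard : B.ncard = A.ncard := by
    have : u '' B = A := by
      ext i
      rw [Set.mem_image_equiv, ← h1]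
      simp
    rw [← this, Set.ncard_image_of_injective _ u.injective]
  have hpos : 0 < A.ncard := (Set.ncard_pos).2 hA
  have hle : A.ncard + A.ncard ≤ n := by
    have := Set.ncard_le_card (A ∪ B)
    rwa [Set.ncard_union_eq hAB, hcard, Nat.card_fin] at this
  set k := A.ncard with hk
  have hn : ({i : Fin n | (i : ℕ) < k}).ncard = k := by
    rw [Set.ncard_eq_toFinset_card', Set.toFinset_ofPred, Fin.card_filter_val_lt]
    omega
  have hn' : ({i : Fin n | n - k ≤ (i : ℕ)}).ncard = k := by
    have : {i : Fin n | n - k ≤ (i : ℕ)} = {i : Fin n | (i : ℕ) < n - k}ᶜ := by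
      ext i; simp
    rw [this, Set.ncard_compl, Set.ncard_eq_toFinset_card', Set.toFinset_ofPred,
      Fin.card_filter_val_lt, Nat.card_fin]
    omega
  obtain ⟨g, hgA, hgB⟩ := exists_perm_mem_iff A B {i : Fin n | (i : ℕ) < k}
    {i : Fin n | n - k ≤ (i : ℕ)} hAB
    (by rw [Set.disjoint_left]; intro i hi hi'; simp only [Set.mem_ofPred_eq] at hi hi'; omega)
    hn.symm (by rw [hcard, hn'])
  simp only [Set.mem_ofPred_eq] at hgA hgB
  have key : ∀ i, (g * u * g⁻¹ * Fin.revPerm : Equiv.Perm (Fin n)) i = g (u (g.symm (Fin.rev i))) :=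
    fun _ => rfl
  refine ⟨k, n - k, g, hpos, by omega, by omega, fun i => ?_, fun i => ?_⟩
  · rw [key, hgA, h1, ← hgB, Equiv.apply_symm_apply, Fin.val_rev]
    omega
  · rw [key, ← not_le, hgB, h2, ← hgA, Equiv.apply_symm_apply, Fin.val_rev]
    omega

/-- In the symmetric group `W = S_n` (`n ≥ 3`), regarded as the Weyl group of type `A_{n−1}` with
the adjacent transpositions as simple reflections, with longest element `w₀ = Fin.revPerm` and
`ε(x) = w₀ x w₀⁻¹`: an element `w` is `D`-anisotropic (for every `x` and every proper `ε`-stable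
subset `I ⊊ S`, `x·w·ε(x)⁻¹ ∉ W_I`) if and only if `w·w₀` has odd order. -/
theorem stmt9 (n : ℕ) (hn : 3 ≤ n) (w : Equiv.Perm (Fin n)) :
    let w₀ : Equiv.Perm (Fin n) := Fin.revPerm
    let S : Set (Equiv.Perm (Fin n)) :=
      {s | ∃ a b : Fin n, (b : ℕ) = (a : ℕ) + 1 ∧ s = Equiv.swap a b}
    ((∀ (x : Equiv.Perm (Fin n)) (I : Set (Equiv.Perm (Fin n))),
        I ⊆ S → I ≠ S → (fun s => w₀ * s * w₀⁻¹) '' I = I →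
        x * w * (w₀ * x * w₀⁻¹)⁻¹ ∉ Subgroup.closure I) ↔
      Odd (orderOf (w * w₀))) := by
  intro w₀ S
  have hw₀ : w₀⁻¹ = w₀ := rfl
  have hw₀' : w₀ * w₀ = 1 := by rw [← hw₀]; exact inv_mul_cancel _
  have hconj : ∀ x : Equiv.Perm (Fin n),
      x * w * (w₀ * x * w₀⁻¹)⁻¹ = x * (w * w₀) * x⁻¹ * w₀ := by
    intro x
    simp only [mul_inv_rev, hw₀, mul_assoc]
  constructor
  · intro h
    by_contra hodd
    obtain ⟨k, l, g, hk, hl, hkl, hgk, hgl⟩ := exists_conj_mul_revPerm_mem (w * w₀) hodd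
    have hstab : ∀ s ∈ {s | s ∈ S ∧ s ∈ initialStabilizer n k ∧ s ∈ initialStabilizer n l},
        w₀ * s * w₀⁻¹ ∈ {s | s ∈ S ∧ s ∈ initialStabilizer n k ∧ s ∈ initialStabilizer n l} := by
      rintro s ⟨⟨a, b, hab, rfl⟩, hsk, hsl⟩
      refine ⟨⟨Fin.rev b, Fin.rev a, ?_, ?_⟩, revPerm_conj_mem_initialStabilizer (by omega) hsl,
        revPerm_conj_mem_initialStabilizer hkl hsk⟩
      · simp only [Fin.val_rev]; omega
      · rw [← Equiv.swap_apply_apply, Equiv.swap_comm]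
        rfl
    refine h g {s | s ∈ S ∧ s ∈ initialStabilizer n k ∧ s ∈ initialStabilizer n l}
      (fun s hs => hs.1) (fun heq => ?_) (Set.Subset.antisymm ?_ ?_) ?_
    · have hab : ((⟨k, by omega⟩ : Fin n) : ℕ) = ((⟨k - 1, by omega⟩ : Fin n) : ℕ) + 1 := by
        simp only; omega
      have hmem : Equiv.swap (⟨k - 1, by omega⟩ : Fin n) ⟨k, by omega⟩ ∈ S := ⟨_, _, hab, rfl⟩
      rw [← heq] at hmem
      exact (swap_mem_initialStabilizer hab).1 hmem.2.1 rfl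
    · rintro _ ⟨s, hs, rfl⟩
      exact hstab s hs
    · intro s hs
      refine ⟨_, hstab s hs, ?_⟩
      simp only [hw₀, mul_assoc, hw₀', mul_one]
      rw [← mul_assoc, hw₀', one_mul]
    · rw [hconj]
      exact mem_closure_of_mem_initialStabilizer hgk hgl
  · intro hodd x I hIS hne hstab hmem
    rw [hconj] at hmem
    obtain ⟨s, ⟨a, b, hab, rfl⟩, hsI⟩ := Set.exists_of_ssubset (hIS.ssubset_of_ne hne)
    have hIb : ∀ t ∈ I, t ∈ initialStabilizer n b := by
      intro t ht
      obtain ⟨c, d, hcd, rfl⟩ := hIS ht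
      rw [swap_mem_initialStabilizer hcd]
      intro hd
      obtain rfl : d = b := Fin.ext hd
      obtain rfl : c = a := Fin.ext (by omega)
      exact hsI ht
    have hIb' : ∀ t ∈ I, t ∈ initialStabilizer n (n - b) := by
      intro t ht
      rw [← hstab] at ht
      obtain ⟨r, hr, rfl⟩ := ht
      exact revPerm_conj_mem_initialStabilizer (by omega) (hIb r hr)
    have hy := (Subgroup.closure_le _).2 hIb hmem
    have hy' := (Subgroup.closure_le _).2 hIb' hmem
    set v := x * (w * w₀) * x⁻¹ with hv
    have hvi : ∀ i, v i = (v * w₀) (Fin.rev i) := by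
      intro i
      change v i = v (Fin.rev (Fin.rev i))
      rw [Fin.rev_rev]
    have hvo : Odd (orderOf v) := by
      rwa [hv, ← MulAut.conj_apply, MulEquiv.orderOf_eq]
    refine not_odd_orderOf_of_interchanges
      (A := {i : Fin n | (i : ℕ) < b ∧ (i : ℕ) < n - b})
      (B := {i : Fin n | ¬ (i : ℕ) < b ∧ ¬ (i : ℕ) < n - b}) ?_ ?_ ?_ ?_ hvo
    · exact ⟨⟨0, by omega⟩, by simp only [Set.mem_ofPred_eq]; omega⟩
    · rw [Set.disjoint_left]
      exact fun i hi hi' => hi'.1 hi.1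
    · rintro i ⟨hi, hi'⟩
      rw [hvi]
      refine ⟨fun hc => ?_, fun hc => ?_⟩
      · have := (hy _).1 hc
        rw [Fin.val_rev] at this
        omega
      · have := (hy' _).1 hc
        rw [Fin.val_rev] at this
        omega
    · rintro i ⟨hi, hi'⟩
      rw [hvi]
      refine ⟨(hy _).2 ?_, (hy' _).2 ?_⟩ <;>
      · rw [Fin.val_rev]
        omega
end

section
/- An element w ∈ W′_n is D-anisotropic (with respect to ε) if and only if the signed permutation w·s_n has no nonzero fixed vector in the reflection representation ℝⁿ of W_n (equivalently, w·s_n has no eigenvalue 1 on ℝⁿ). -/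
namespace SignedPerm

/-- The simultaneous transposition of the letters `a, b` and of `a′, b′`. -/
def sswap {n : ℕ} (a b : Fin n) : Equiv.Perm (Fin n × Bool) :=
  Equiv.swap (a, true) (b, true) * Equiv.swap (a, false) (b, false)

/-- The sign change at the letter `a`. -/
def signChange {n : ℕ} (a : Fin n) : Equiv.Perm (Fin n × Bool) :=
  Equiv.swap (a, true) (a, false)

/-- The involution `i ↔ i′`. -/
def prime (n : ℕ) : Equiv.Perm (Fin n × Bool) :=
  ⟨fun p => (p.1, !p.2), fun p => (p.1, !p.2), fun p => by simp, fun p => by simp⟩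

/-- The first `k` unprimed letters. -/
def initialLetters (n k : ℕ) : Set (Fin n × Bool) := {p | p.1.val < k ∧ p.2 = true}

/-- The permutations stabilizing the set of the first `k` unprimed letters. -/
def initialStabilizer (n k : ℕ) : Subgroup (Equiv.Perm (Fin n × Bool)) where
  carrier := {u | ∀ p, u p ∈ initialLetters n k ↔ p ∈ initialLetters n k}
  mul_mem' {u v} hu hv p := by rw [Equiv.Perm.mul_apply, hu, hv]
  one_mem' p := Iff.rfl
  inv_mem' {u} hu p := by
    rw [← hu (u⁻¹ p), ← Equiv.Perm.mul_apply, mul_inv_cancel, Equiv.Perm.one_apply]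

/-- The odd extension of `f` to all letters. -/
def oddExt {n : ℕ} (f : Fin n → ℝ) (p : Fin n × Bool) : ℝ := if p.2 then f p.1 else - f p.1

variable {n : ℕ}

lemma sswap_apply (a b i : Fin n) (c : Bool) : sswap a b (i, c) = (Equiv.swap a b i, c) := by
  cases c <;> simp only [sswap, Equiv.Perm.mul_apply, Equiv.swap_apply_def] <;> grind

lemma signChange_apply (a i : Fin n) (c : Bool) :
    signChange a (i, c) = (i, if i = a then !c else c) := by
  cases c <;> simp only [signChange, Equiv.swap_apply_def] <;> grind

lemma prime_apply (i : Fin n) (c : Bool) : prime n (i, c) = (i, !c) := rfl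

lemma sign_sswap (a b : Fin n) : Equiv.Perm.sign (sswap a b) = 1 := by
  rcases eq_or_ne a b with rfl | h
  · simp [sswap]
  · simp [sswap, h]

lemma sign_signChange (a : Fin n) : Equiv.Perm.sign (signChange a) = -1 := by
  simp [signChange]

lemma signChange_mul_self (a : Fin n) : signChange a * signChange a = 1 := by
  simp [signChange]

lemma signChange_inv (a : Fin n) : (signChange a)⁻¹ = signChange a := by
  simp [signChange]

lemma mem_centralizer_prime {u : Equiv.Perm (Fin n × Bool)} :
    u ∈ Subgroup.centralizer {prime n} ↔ ∀ p, u (prime n p) = prime n (u p) := by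
  rw [Subgroup.mem_centralizer_singleton_iff, Equiv.ext_iff]
  rfl

lemma sswap_mem_centralizer (a b : Fin n) : sswap a b ∈ Subgroup.centralizer {prime n} := by
  rw [mem_centralizer_prime]
  rintro ⟨i, c⟩
  simp [prime_apply, sswap_apply]

lemma signChange_mem_centralizer (a : Fin n) :
    signChange a ∈ Subgroup.centralizer {prime n} := by
  rw [mem_centralizer_prime]
  rintro ⟨i, c⟩
  simp only [prime_apply, signChange_apply]
  cases c <;> split_ifs <;> rfl

lemma signChange_mem_initialStabilizer {k : ℕ} {a : Fin n} (h : k ≤ a.val) :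
    signChange a ∈ initialStabilizer n k := by
  rintro ⟨i, c⟩
  simp only [signChange_apply, initialLetters, Set.mem_ofPred_eq]
  grind

lemma sswap_mem_initialStabilizer {k : ℕ} {a b : Fin n} (h : a.val < k ↔ b.val < k) :
    sswap a b ∈ initialStabilizer n k := by
  rintro ⟨i, c⟩
  simp only [sswap_apply, initialLetters, Set.mem_ofPred_eq, Equiv.swap_apply_def]
  grind

lemma sswap_mul_sswap_mul_sswap {a b c : Fin n} (hab : a ≠ b) (hac : a ≠ c) :
    sswap b c * sswap a b * sswap b c = sswap a c := by
  ext1 ⟨i, d⟩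
  cases d <;> simp only [Equiv.Perm.mul_apply, sswap_apply, Equiv.swap_apply_def] <;> grind

lemma sswap_mul_signChange_mul_signChange_mul_sswap {a b c : Fin n} (hab : a ≠ b) (hcb : c ≠ b) :
    sswap a c * (signChange c * signChange b) * sswap a c = signChange a * signChange b := by
  ext1 ⟨i, d⟩
  cases d <;> simp only [Equiv.Perm.mul_apply, sswap_apply, signChange_apply,
    Equiv.swap_apply_def] <;> grind

lemma sswap_comm (a b : Fin n) : sswap a b = sswap b a := by
  simp [sswap, Equiv.swap_comm]

lemma signChange_comm (a b : Fin n) :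
    signChange a * signChange b = signChange b * signChange a := by
  ext1 ⟨i, d⟩
  cases d <;> simp only [Equiv.Perm.mul_apply, signChange_apply] <;> grind

lemma signChange_conj_sswap {a b : Fin n} (h : a ≠ b) :
    signChange b * sswap a b * signChange b * sswap a b = signChange a * signChange b := by
  ext1 ⟨i, d⟩
  cases d <;> simp only [Equiv.Perm.mul_apply, signChange_apply, sswap_apply,
    Equiv.swap_apply_def] <;> grind

lemma signChange_conj_sswap_of_ne {a b c : Fin n} (ha : a ≠ c) (hb : b ≠ c) :
    signChange c * sswap a b * signChange c = sswap a b := by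
  ext1 ⟨i, d⟩
  cases d <;> simp only [Equiv.Perm.mul_apply, signChange_apply, sswap_apply,
    Equiv.swap_apply_def] <;> grind


lemma eq_of_apply_fst_eq {u : Equiv.Perm (Fin n × Bool)}
    (hu : u ∈ Subgroup.centralizer {prime n}) {i j : Fin n}
    (h : (u (i, true)).1 = (u (j, true)).1) : i = j := by
  rw [mem_centralizer_prime] at hu
  by_cases h2 : (u (i, true)).2 = (u (j, true)).2
  · exact congrArg Prod.fst (u.injective (Prod.ext h h2))
  · have : u (i, true) = u (j, false) := by
      refine Eq.trans ?_ (hu (j, true)).symm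
      exact Prod.ext h (Bool.eq_not_of_ne h2)
    exact congrArg Prod.fst (u.injective this)

lemma eq_of_apply_true_eq {u v : Equiv.Perm (Fin n × Bool)}
    (hu : u ∈ Subgroup.centralizer {prime n}) (hv : v ∈ Subgroup.centralizer {prime n})
    (h : ∀ i, u (i, true) = v (i, true)) : u = v := by
  rw [mem_centralizer_prime] at hu hv
  ext1 ⟨i, c⟩
  cases c
  · exact (hu (i, true)).trans ((congrArg _ (h i)).trans (hv (i, true)).symm)
  · exact h i

lemma val_lt_iff_of_mem_initialStabilizer {k : ℕ} {u : Equiv.Perm (Fin n × Bool)}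
    (hu : u ∈ Subgroup.centralizer {prime n}) (hk : u ∈ initialStabilizer n k) (i : Fin n) :
    i.val < k ↔ (u (i, true)).1.val < k := by
  rw [mem_centralizer_prime] at hu
  have h1 : u (i, true) ∈ initialLetters n k ↔ _ := hk (i, true)
  have h2 : u (prime n (i, true)) ∈ initialLetters n k ↔ _ := hk (i, false)
  rw [hu] at h2
  simp only [initialLetters, prime, Set.mem_ofPred_eq, Equiv.coe_fn_mk] at h1 h2
  grind

/-- A subgroup containing the transpositions within the blocks `[0, k)` and `[k, n)` and the
double sign changes in the second block contains every even signed permutation that stabilizes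
the first `k` letters. -/
lemma mem_of_mem_initialStabilizer {k : ℕ} {G : Subgroup (Equiv.Perm (Fin n × Bool))}
    (hswap : ∀ a b : Fin n, (a.val < k ↔ b.val < k) → sswap a b ∈ G)
    (hsign : ∀ a b : Fin n, k ≤ a.val → k ≤ b.val → a ≠ b → signChange a * signChange b ∈ G)
    (u : Equiv.Perm (Fin n × Bool)) (hu : u ∈ Subgroup.centralizer {prime n})
    (hk : u ∈ initialStabilizer n k) (hs : Equiv.Perm.sign u = 1) : u ∈ G := by
  induction hm : (Finset.univ.filter fun i => (u (i, true)).1 ≠ i).card +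
      (Finset.univ.filter fun i => u (i, true) ≠ (i, true)).card using Nat.strong_induction_on
    generalizing u with
  | _ m ih =>
  by_cases h : ∃ i, (u (i, true)).1 ≠ i
  · obtain ⟨i, hi⟩ := h
    have hlt := val_lt_iff_of_mem_initialStabilizer hu hk i
    generalize hj : (u (i, true)).1 = j at hi hlt
    have key : ∀ l, (u (l, true)).1 = l →
        (sswap i j * u) (l, true) = u (l, true) := by
      intro l hl
      have hlj : l ≠ j := by
        rintro rfl
        exact hi (eq_of_apply_fst_eq hu (hl.trans hj.symm))
      have hli : l ≠ i := by
        rintro rfl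
        exact hi (hj.symm.trans hl)
      have h2 : u (l, true) = (l, (u (l, true)).2) := Prod.ext hl rfl
      rw [Equiv.Perm.mul_apply, h2, sswap_apply, Equiv.swap_apply_of_ne_of_ne hli hlj]
    have hji : ((sswap i j * u) (i, true)).1 = i := by
      have h2 : u (i, true) = (j, (u (i, true)).2) := Prod.ext hj rfl
      rw [Equiv.Perm.mul_apply, h2, sswap_apply, Equiv.swap_apply_right]
    rw [← G.mul_mem_cancel_left (hswap i j hlt)]
    refine ih _ ?_ _ (mul_mem (sswap_mem_centralizer i j) hu)
      (mul_mem (sswap_mem_initialStabilizer hlt) hk) (by simp [sign_sswap, hs]) rfl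
    rw [← hm]
    refine Nat.add_lt_add_of_lt_of_le (Finset.card_lt_card ?_) (Finset.card_le_card ?_)
    · rw [Finset.ssubset_iff_of_subset]
      · exact ⟨i, by simpa [hj] using hi, by
          simp only [Finset.mem_filter, Finset.mem_univ, true_and, not_not, hji]⟩
      · intro l
        simp only [Finset.mem_filter, Finset.mem_univ, true_and]
        intro h1 h2
        exact h1 (by rw [key l h2, h2])
    · intro l
      simp only [Finset.mem_filter, Finset.mem_univ, true_and]
      intro h1 h2
      exact h1 (by rw [key l (by rw [h2]), h2])
  · push Not at h
    have hval : ∀ i, u (i, true) ≠ (i, true) → u (i, true) = (i, false) := fun i hi =>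
      Prod.ext (h i) (Bool.eq_false_of_not_eq_true fun h' => hi (Prod.ext (h i) h'))
    by_cases h1 : ∃ a, u (a, true) ≠ (a, true)
    · obtain ⟨a, ha⟩ := h1
      by_cases h2 : ∃ b ≠ a, u (b, true) ≠ (b, true)
      · obtain ⟨b, hba, hb⟩ := h2
        have hle : ∀ l, u (l, true) ≠ (l, true) → k ≤ l.val := by
          intro l hl
          by_contra! hlk
          have := ((hk (l, true)).2 ⟨hlk, rfl⟩).2
          rw [hval l hl] at this
          cases this
        rw [← G.mul_mem_cancel_left (hsign a b (hle a ha) (hle b hb) hba.symm)]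
        have key : ∀ l, ((signChange a * signChange b * u) (l, true)).1 = l ∧
            ((signChange a * signChange b * u) (l, true) ≠ (l, true) →
              u (l, true) ≠ (l, true) ∧ l ≠ a) := by
          intro l
          by_cases hl : u (l, true) = (l, true)
          · have hla : l ≠ a := by
              rintro rfl
              exact ha hl
            have hlb : l ≠ b := by
              rintro rfl
              exact hb hl
            simp [Equiv.Perm.mul_apply, hl, signChange_apply, hla, hlb]
          · simp only [Equiv.Perm.mul_apply, hval l hl, signChange_apply]
            grind
        refine ih _ ?_ _ (mul_mem (mul_mem (signChange_mem_centralizer a)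
          (signChange_mem_centralizer b)) hu)
          (mul_mem (mul_mem (signChange_mem_initialStabilizer (hle a ha))
          (signChange_mem_initialStabilizer (hle b hb))) hk)
          (by simp [sign_signChange, hs]) rfl
        rw [← hm]
        refine Nat.add_lt_add_of_le_of_lt (Finset.card_le_card ?_) (Finset.card_lt_card ?_)
        · intro l hl
          exact absurd (key l).1 (Finset.mem_filter.1 hl).2
        · rw [Finset.ssubset_iff_of_subset]
          · refine ⟨a, by simpa using ha, fun hl => ?_⟩
            exact ((key a).2 (Finset.mem_filter.1 hl).2).2 rfl
          · intro l hl
            exact Finset.mem_filter.2 ⟨Finset.mem_univ _,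
              ((key l).2 (Finset.mem_filter.1 hl).2).1⟩
      · push Not at h2
        have : u = signChange a := by
          refine eq_of_apply_true_eq hu (signChange_mem_centralizer a) fun l => ?_
          rcases eq_or_ne l a with rfl | hl
          · simp [hval l ha, signChange_apply]
          · simp [h2 l hl, signChange_apply, hl]
        rw [this, sign_signChange] at hs
        exact absurd hs (by decide)
    · push Not at h1
      have : u = 1 := eq_of_apply_true_eq hu (one_mem _) h1
      exact this ▸ one_mem G

/-- A signed permutation without sign changes is even. -/
lemma sign_eq_one_of_mem_initialStabilizer_self {u : Equiv.Perm (Fin n × Bool)}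
    (hu : u ∈ Subgroup.centralizer {prime n}) (hk : u ∈ initialStabilizer n n) :
    Equiv.Perm.sign u = 1 := by
  have h1 : ∀ i, u (i, true) = ((u (i, true)).1, true) := fun i =>
    Prod.ext rfl ((hk (i, true)).2 ⟨i.2, rfl⟩).2
  have h2 : ∀ i, u (i, false) = ((u (i, true)).1, false) := fun i => by
    have := mem_centralizer_prime.1 hu (i, true)
    rw [h1] at this
    exact this
  let g : Equiv.Perm (Fin n) := Equiv.ofBijective (fun i => (u (i, true)).1)
    (Finite.injective_iff_bijective.1 fun i j h => eq_of_apply_fst_eq hu h)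
  have hg : u = Equiv.prodCongrLeft fun _ : Bool => g := by
    ext1 ⟨i, c⟩
    cases c
    · exact h2 i
    · exact h1 i
  rw [hg, Equiv.Perm.sign_prodCongrLeft]
  simp

/-- A vector can be moved by a signed permutation to one whose positive coordinates are the
first ones and whose other coordinates vanish. -/
lemma exists_initialLetters_iff_oddExt_pos (f : Fin n → ℝ) :
    ∃ k ≤ n, (f ≠ 0 → 0 < k) ∧ ∃ x ∈ Subgroup.centralizer {prime n},
      ∀ p, x p ∈ initialLetters n k ↔ 0 < oddExt f p := by
  let k := Fintype.card {i // f i ≠ 0}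
  have hkn : k ≤ n := (Fintype.card_subtype_le _).trans_eq (Fintype.card_fin n)
  have hcard : Fintype.card {i // f i ≠ 0} = Fintype.card {i : Fin n // i.val < k} := by
    rw [Fintype.card_congr (Fin.castLEquiv hkn).symm, Fintype.card_fin]
  let π : Equiv.Perm (Fin n) := (Fintype.equivOfCardEq hcard).extendSubtype
  have hπ : ∀ i, (π i).val < k ↔ f i ≠ 0 := fun i =>
    ⟨fun h => by_contra fun h' =>
        (Equiv.extendSubtype_not_mem (Fintype.equivOfCardEq hcard) i h') h,
      fun h => Equiv.extendSubtype_mem (Fintype.equivOfCardEq hcard) i h⟩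
  let x : Equiv.Perm (Fin n × Bool) := Equiv.prodShear π fun i =>
    if f i < 0 then Equiv.boolNot else Equiv.refl Bool
  refine ⟨k, hkn, fun hf => ?_, x, ?_, ?_⟩
  · obtain ⟨i, hi⟩ := Function.ne_iff.1 hf
    exact Fintype.card_pos_iff.2 ⟨⟨i, hi⟩⟩
  · rw [mem_centralizer_prime]
    rintro ⟨i, c⟩
    simp only [x, prime, Equiv.prodShear_apply, Equiv.coe_fn_mk]
    split_ifs <;> simp
  · rintro ⟨i, c⟩
    simp only [x, initialLetters, oddExt, Set.mem_ofPred_eq, Equiv.prodShear_apply, hπ]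
    rcases lt_trichotomy (f i) 0 with h | h | h
    · cases c <;> simp [h, h.ne, h.le]
    · simp [h]
    · cases c <;> simp [h, h.ne', h.not_gt]

lemma oddExt_prime (f : Fin n → ℝ) (p : Fin n × Bool) : oddExt f (prime n p) = - oddExt f p := by
  obtain ⟨i, c⟩ := p
  cases c <;> simp [oddExt, prime]

lemma sub_one_lt_self (hn : 2 ≤ n) : n - 1 < n := by omega

lemma sub_two_lt_self (hn : 2 ≤ n) : n - 2 < n := by omega

/-- The last index. -/
abbrev last (hn : 2 ≤ n) : Fin n := ⟨n - 1, sub_one_lt_self hn⟩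

/-- The last index but one. -/
abbrev penult (hn : 2 ≤ n) : Fin n := ⟨n - 2, sub_two_lt_self hn⟩

/-- The simple reflections of `W′_n`. -/
def simpleReflections (n : ℕ) (hn : 2 ≤ n) : Set (Equiv.Perm (Fin n × Bool)) :=
  {s | ∃ a b : Fin n, (b : ℕ) = (a : ℕ) + 1 ∧ s = sswap a b} ∪
    {signChange (last hn) * sswap (penult hn) (last hn) *
      signChange (last hn)}

/-- A proper `ε`-stable parabolic subgroup stabilizes a nonempty proper initial segment. -/
lemma exists_closure_le_initialStabilizer (hn : 2 ≤ n) {I : Set (Equiv.Perm (Fin n × Bool))}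
    (hI : I ⊆ simpleReflections n hn) (hne : I ≠ simpleReflections n hn)
    (hε : ∀ g ∈ I, signChange (last hn) * g * signChange (last hn) ∈ I) :
    ∃ k, 0 < k ∧ k < n ∧ Subgroup.closure I ≤ initialStabilizer n k := by
  suffices h : ∃ a b : Fin n, (b : ℕ) = (a : ℕ) + 1 ∧ sswap a b ∉ I ∧ (b.val = n - 1 →
      signChange (last hn) * sswap (penult hn) (last hn) *
        signChange (last hn) ∉ I) by
    obtain ⟨a, b, hab, hI1, hI2⟩ := h
    refine ⟨b, by omega, b.2, (Subgroup.closure_le _).2 fun g hg => ?_⟩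
    rcases hI hg with ⟨c, d, hcd, rfl⟩ | rfl
    · refine sswap_mem_initialStabilizer ?_
      have : c ≠ a := by
        rintro rfl
        obtain rfl : b = d := Fin.ext (hab.trans hcd.symm)
        exact hI1 hg
      rw [Ne, Fin.ext_iff] at this
      omega
    · have hb : b.val ≠ n - 1 := fun h => hI2 h hg
      have := b.2
      refine mul_mem (mul_mem (signChange_mem_initialStabilizer ?_)
        (sswap_mem_initialStabilizer ?_)) (signChange_mem_initialStabilizer ?_) <;>
      simp only <;> omega
  obtain ⟨s, hs, hsI⟩ : ∃ s ∈ simpleReflections n hn, s ∉ I := by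
    by_contra! h
    exact hne (hI.antisymm h)
  rcases hs with ⟨a, b, hab, rfl⟩ | rfl
  · refine ⟨a, b, hab, hsI, fun hb hmem => hsI ?_⟩
    have ha' : a = penult hn := Fin.ext (by simp only; omega)
    have hb' : b = last hn := Fin.ext hb
    rw [ha', hb']
    have := hε _ hmem
    simp only [← mul_assoc, signChange_mul_self, one_mul] at this
    simpa only [mul_assoc, signChange_mul_self, mul_one] using this
  · exact ⟨penult hn, last hn, by simp only; omega, fun h => hsI (hε _ h),
      fun _ => hsI⟩

/-- Every even signed permutation stabilizing a nonempty proper initial segment lies in the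
parabolic subgroup generated by the simple reflections with this property. -/
lemma mem_closure_simpleReflections_inter (hn : 2 ≤ n) {k : ℕ} (hkn : k < n)
    (u : Equiv.Perm (Fin n × Bool)) (hu : u ∈ Subgroup.centralizer {prime n})
    (hk : u ∈ initialStabilizer n k) (hs : Equiv.Perm.sign u = 1) :
    u ∈ Subgroup.closure (simpleReflections n hn ∩ initialStabilizer n k) := by
  have hlt : ∀ d : ℕ, ∀ a b : Fin n, b.val = a.val + 1 + d → (a.val < k ↔ b.val < k) →
      sswap a b ∈ Subgroup.closure (simpleReflections n hn ∩ initialStabilizer n k) := by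
    intro d
    induction d with
    | zero =>
      intro a b hab h
      exact Subgroup.subset_closure ⟨Or.inl ⟨a, b, hab, rfl⟩, sswap_mem_initialStabilizer h⟩
    | succ d ih =>
      intro a b hab h
      have hb := b.2
      let c : Fin n := ⟨a.val + 1 + d, by omega⟩
      have hc : c.val = a.val + 1 + d := rfl
      have hcb : sswap c b ∈
          Subgroup.closure (simpleReflections n hn ∩ initialStabilizer n k) :=
        Subgroup.subset_closure ⟨Or.inl ⟨c, b, by omega, rfl⟩,
          sswap_mem_initialStabilizer (by omega)⟩
      rw [← sswap_mul_sswap_mul_sswap (a := a) (b := c) (c := b) (by rw [Ne, Fin.ext_iff]; omega)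
        (by rw [Ne, Fin.ext_iff]; omega)]
      exact mul_mem (mul_mem hcb (ih a c hc (by omega))) hcb
  have hswap : ∀ a b : Fin n, (a.val < k ↔ b.val < k) →
      sswap a b ∈ Subgroup.closure (simpleReflections n hn ∩ initialStabilizer n k) := by
    intro a b h
    rcases lt_trichotomy a b with hab | rfl | hab
    · rw [Fin.lt_def] at hab
      exact hlt (b.val - a.val - 1) a b (by omega) h
    · have h1 : sswap a a = 1 := by
        rw [sswap, Equiv.swap_self, Equiv.swap_self]
        rfl
      exact h1 ▸ one_mem _
    · rw [Fin.lt_def] at hab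
      rw [sswap_comm]
      exact hlt (a.val - b.val - 1) b a (by omega) h.symm
  have hlast : ∀ a : Fin n, k ≤ a.val → a ≠ last hn →
      signChange a * signChange (last hn) ∈
        Subgroup.closure (simpleReflections n hn ∩ initialStabilizer n k) := by
    intro a hka ha
    have ha' := a.2
    have han : a.val ≠ n - 1 := fun h => ha (Fin.ext h)
    have hne : (penult hn) ≠ last hn := by
      rw [Ne, Fin.ext_iff]
      simp only
      omega
    rw [← sswap_mul_signChange_mul_signChange_mul_sswap (c := penult hn) ha hne,
      ← signChange_conj_sswap hne]
    have h1 := hswap a (penult hn) (by simp only; omega)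
    have h2 := hswap (penult hn) (last hn) (by simp only; omega)
    refine mul_mem (mul_mem h1 (mul_mem (Subgroup.subset_closure ⟨Or.inr rfl, ?_⟩) h2)) h1
    refine mul_mem (mul_mem (signChange_mem_initialStabilizer ?_)
      (sswap_mem_initialStabilizer ?_)) (signChange_mem_initialStabilizer ?_) <;>
    simp only <;> omega
  refine mem_of_mem_initialStabilizer hswap (fun a b ha hb hab => ?_) u hu hk hs
  by_cases h1 : a = last hn
  · rw [signChange_comm, h1]
    exact hlast b hb (h1 ▸ hab.symm)
  by_cases h2 : b = last hn
  · rw [h2]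
    exact hlast a ha h1
  have := mul_mem (hlast a ha h1) (hlast b hb h2)
  rwa [signChange_comm b, mul_assoc, ← mul_assoc (signChange (last hn)), signChange_mul_self,
    one_mul] at this

lemma signChange_conj_mem_simpleReflections (hn : 2 ≤ n) {g : Equiv.Perm (Fin n × Bool)}
    (hg : g ∈ simpleReflections n hn) :
    signChange (last hn) * g * signChange (last hn) ∈
      simpleReflections n hn := by
  rcases hg with ⟨a, b, hab, rfl⟩ | rfl
  · by_cases hb : b.val = n - 1
    · have ha' : a = penult hn := Fin.ext (by simp only; omega)
      have hb' : b = last hn := Fin.ext hb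
      rw [ha', hb']
      exact Or.inr rfl
    · have hb' := b.2
      refine Or.inl ⟨a, b, hab, signChange_conj_sswap_of_ne ?_ ?_⟩ <;>
      rw [Ne, Fin.ext_iff] <;> simp only <;> omega
  · refine Or.inl ⟨penult hn, last hn, by simp only; omega, ?_⟩
    simp only [← mul_assoc, signChange_mul_self, one_mul]
    simp only [mul_assoc, signChange_mul_self, mul_one]

/-- If `w s_n` fixes no nonzero vector, then `w` is anisotropic. -/
lemma notMem_closure_of_forall_fixed_eq_zero (hn : 2 ≤ n)
    {w x : Equiv.Perm (Fin n × Bool)} {I : Set (Equiv.Perm (Fin n × Bool))}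
    (hw : w ∈ Subgroup.centralizer {prime n}) (hx : x ∈ Subgroup.centralizer {prime n})
    (hI : I ⊆ simpleReflections n hn) (hne : I ≠ simpleReflections n hn)
    (hε : (fun g => signChange (last hn) * g * (signChange (last hn))⁻¹) '' I = I)
    (hfix : ∀ f : Fin n → ℝ,
      (fun i => oddExt f ((w * signChange (last hn))⁻¹ (i, true))) = f → f = 0) :
    x * w * (signChange (last hn) * x * (signChange (last hn))⁻¹)⁻¹ ∉
      Subgroup.closure I := by
  intro hmem
  rw [signChange_inv] at hε
  obtain ⟨k, hk0, hkn, hle⟩ := exists_closure_le_initialStabilizer hn hI hne fun g hg => by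
    have := Set.mem_image_of_mem
      (fun g => signChange (last hn) * g * signChange (last hn)) hg
    rwa [hε] at this
  have hv : x * (w * signChange (last hn)) * x⁻¹ ∈ initialStabilizer n k := by
    have := mul_mem (hle hmem) (signChange_mem_initialStabilizer (k := k)
      (a := last hn) (by simp only; omega))
    simpa only [mul_inv_rev, inv_inv, mul_assoc, signChange_inv, signChange_mul_self,
      mul_one] using this
  have hvc : (w * signChange (last hn))⁻¹ ∈ Subgroup.centralizer {prime n} :=
    inv_mem (mul_mem hw (signChange_mem_centralizer _))
  generalize w * signChange (last hn) = v at hv hfix hvc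
  rw [mem_centralizer_prime] at hvc hx
  classical
  let F : Fin n × Bool → ℝ := fun p => (if x p ∈ initialLetters n k then 1 else 0) -
    if x (prime n p) ∈ initialLetters n k then 1 else 0
  have hF : ∀ p, oddExt (fun i => F (i, true)) p = F p := by
    rintro ⟨i, c⟩
    cases c <;> simp [oddExt, F, prime_apply]
  have hstab : ∀ p, x (v⁻¹ p) ∈ initialLetters n k ↔ x p ∈ initialLetters n k := by
    intro p
    have := inv_mem hv (x p)
    simpa using this
  have h0 := hfix (fun i => F (i, true)) (funext fun i => by
    rw [hF]
    simp only [F, ← hvc, hstab])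
  have h1 : F (x⁻¹ (⟨0, by omega⟩, true)) = 0 := by
    rw [← hF, h0]
    simp [oddExt]
  simp [F, hx, initialLetters, prime_apply, hk0] at h1

/-- If `w s_n` fixes a nonzero vector, then `w` is not anisotropic. -/
lemma exists_mem_closure_of_fixed_ne_zero (hn : 2 ≤ n)
    {w : Equiv.Perm (Fin n × Bool)} (hw : w ∈ Subgroup.centralizer {prime n})
    (hws : Equiv.Perm.sign w = 1) {f : Fin n → ℝ} (hf0 : f ≠ 0)
    (hf : (fun i => oddExt f ((w * signChange (last hn))⁻¹ (i, true))) = f) :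
    ∃ x ∈ Subgroup.centralizer {prime n}, Equiv.Perm.sign x = 1 ∧
      ∃ I ⊆ simpleReflections n hn, I ≠ simpleReflections n hn ∧
        (fun g => signChange (last hn) * g * (signChange (last hn))⁻¹) '' I = I ∧
        x * w * (signChange (last hn) * x * (signChange (last hn))⁻¹)⁻¹ ∈
          Subgroup.closure I := by
  obtain ⟨k, hkn, hk0, x, hx, hxf⟩ := exists_initialLetters_iff_oddExt_pos f
  replace hk0 := hk0 hf0
  have hlast : signChange (last hn) ∈ Subgroup.centralizer {prime n} :=
    signChange_mem_centralizer _
  have hvc : w * signChange (last hn) ∈ Subgroup.centralizer {prime n} :=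
    mul_mem hw hlast
  have hfv : ∀ p, oddExt f ((w * signChange (last hn))⁻¹ p) = oddExt f p := by
    rintro ⟨i, c⟩
    cases c
    · rw [← Bool.not_true, ← prime_apply, mem_centralizer_prime.1 (inv_mem hvc), oddExt_prime,
        oddExt_prime]
      exact congrArg Neg.neg (congrFun hf i)
    · exact congrFun hf i
  have hstab : ∀ y : Equiv.Perm (Fin n × Bool), (∀ p, y p ∈ initialLetters n k ↔ 0 < oddExt f p) →
      y * (w * signChange (last hn)) * y⁻¹ ∈ initialStabilizer n k := by
    intro y hy
    rw [← inv_mem_iff]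
    intro p
    rw [← Equiv.apply_symm_apply y p, hy, ← hfv, ← hy]
    simp
  have hlt : k < n := by
    refine lt_of_le_of_ne hkn ?_
    rintro rfl
    have := sign_eq_one_of_mem_initialStabilizer_self
      (mul_mem (mul_mem hx hvc) (inv_mem hx)) (hstab x hxf)
    simp [hws, sign_signChange] at this
  have hlastk : signChange (last hn) ∈ initialStabilizer n k :=
    signChange_mem_initialStabilizer (by simp only; omega)
  obtain ⟨y, hy, hys, hyf⟩ : ∃ y ∈ Subgroup.centralizer {prime n}, Equiv.Perm.sign y = 1 ∧
      ∀ p, y p ∈ initialLetters n k ↔ 0 < oddExt f p := by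
    rcases Int.units_eq_one_or (Equiv.Perm.sign x) with h | h
    · exact ⟨x, hx, h, hxf⟩
    · exact ⟨signChange (last hn) * x, mul_mem hlast hx,
        by rw [map_mul, h, sign_signChange, neg_mul_neg, one_mul],
        fun p => (hlastk (x p)).trans (hxf p)⟩
  refine ⟨y, hy, hys, simpleReflections n hn ∩ initialStabilizer n k, Set.inter_subset_left,
    fun h => ?_, ?_, mem_closure_simpleReflections_inter hn hlt _ ?_ ?_ ?_⟩
  · have hmem : sswap (⟨k - 1, by omega⟩ : Fin n) ⟨k, hlt⟩ ∈ simpleReflections n hn :=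
      Or.inl ⟨_, _, by simp only; omega, rfl⟩
    rw [← h] at hmem
    have := (hmem.2 (⟨k - 1, by omega⟩, true)).2 ⟨by simp only; omega, rfl⟩
    rw [sswap_apply, Equiv.swap_apply_left] at this
    exact lt_irrefl k this.1
  · have hmaps : ∀ g ∈ simpleReflections n hn ∩ initialStabilizer n k,
        signChange (last hn) * g * signChange (last hn) ∈
          simpleReflections n hn ∩ initialStabilizer n k := fun g hg =>
      ⟨signChange_conj_mem_simpleReflections hn hg.1, mul_mem (mul_mem hlastk hg.2) hlastk⟩
    rw [signChange_inv]
    refine Set.Subset.antisymm (Set.image_subset_iff.2 hmaps) fun g hg => ⟨_, hmaps g hg, ?_⟩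
    simp only [← mul_assoc, signChange_mul_self, one_mul]
    simp only [mul_assoc, signChange_mul_self, mul_one]
  · exact mul_mem (mul_mem hy hw) (inv_mem (mul_mem (mul_mem hlast hy) (inv_mem hlast)))
  · have := mul_mem (hstab y hyf) hlastk
    simpa only [mul_inv_rev, inv_inv, mul_assoc, signChange_inv] using this
  · simp [hys, hws]

end SignedPerm

/-- Let `W_n` be the hyperoctahedral group, realized as the permutations of
`{1,…,n} × {±}` (here `Fin n × Bool`) commuting with the sign-flip involution `τ`, and let
`W′_n = ker χ` be its type-`D_n` subgroup, where `χ` is the character sending the simple signed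
transpositions `s_j` (`j < n`) to `1` and `s_n` to `−1` (realized here as the sign character of
permutations of `Fin n × Bool`).  With simple reflections
`S = {s_1, …, s_{n−1}, s_n s_{n−1} s_n}` and `ε = conjugation by s_n`, an element `w ∈ W′_n` is
`D`-anisotropic if and only if the signed permutation `w·s_n` has no nonzero fixed vector in the
reflection representation `ℝⁿ` of `W_n` (equivalently, no eigenvalue `1`). -/
theorem stmt10 (n : ℕ) (hn : 2 ≤ n) :
    let τ : Equiv.Perm (Fin n × Bool) :=
      ⟨fun p => (p.1, !p.2), fun p => (p.1, !p.2), fun p => by simp, fun p => by simp⟩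
    let Wn : Subgroup (Equiv.Perm (Fin n × Bool)) := Subgroup.centralizer {τ}
    let W'n : Subgroup (Equiv.Perm (Fin n × Bool)) := Wn ⊓ (Equiv.Perm.sign).ker
    let sswap : Fin n → Fin n → Equiv.Perm (Fin n × Bool) := fun a b =>
      Equiv.swap (a, true) (b, true) * Equiv.swap (a, false) (b, false)
    let sn : Equiv.Perm (Fin n × Bool) :=
      Equiv.swap (⟨n - 1, by omega⟩, true) (⟨n - 1, by omega⟩, false)
    let S : Set (Equiv.Perm (Fin n × Bool)) :=
      {s | ∃ a b : Fin n, (b : ℕ) = (a : ℕ) + 1 ∧ s = sswap a b} ∪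
        {sn * sswap ⟨n - 2, by omega⟩ ⟨n - 1, by omega⟩ * sn}
    ∀ w ∈ W'n,
      ((∀ x ∈ W'n, ∀ I : Set (Equiv.Perm (Fin n × Bool)),
          I ⊆ S → I ≠ S → (fun g => sn * g * sn⁻¹) '' I = I →
          x * w * (sn * x * sn⁻¹)⁻¹ ∉ Subgroup.closure I) ↔
        ∀ f : Fin n → ℝ,
          (fun i : Fin n =>
            if ((w * sn)⁻¹ (i, true)).2 then f ((w * sn)⁻¹ (i, true)).1
            else - f ((w * sn)⁻¹ (i, true)).1) = f → f = 0) := by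
  intro τ Wn W'n sswap sn S w hw
  constructor
  · intro h f hf
    by_contra hf0
    obtain ⟨x, hx, hxs, I, hI, hne, hε, hmem⟩ :=
      SignedPerm.exists_mem_closure_of_fixed_ne_zero hn hw.1 hw.2 hf0 hf
    exact h x ⟨hx, hxs⟩ I hI hne hε hmem
  · intro h x hx I hI hne hε
    exact SignedPerm.notMem_closure_of_forall_fixed_eq_zero hn hw.1 hx.1 hI hne hε h
end

section
/- If m ≥ n, then every (S, T) ∈ X_n^{m+1} satisfies 0 ∈ S and 0 ∈ T, and consequently the shift map X_n^m → X_n^{m+1} is a bijection. -/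
/-- Membership in the set `X_n^m` of "symbols": ordered pairs `(S, T)` of distinct finite subsets
of `ℕ` with `|S| = |T| = m` and `Σ_{x∈S} x + Σ_{x∈T} x = n + m² − m`. -/
def XnmMem (n m : ℕ) (p : Finset ℕ × Finset ℕ) : Prop :=
  p.1 ≠ p.2 ∧ p.1.card = m ∧ p.2.card = m ∧
    (∑ x ∈ p.1, x) + (∑ x ∈ p.2, x) = n + m ^ 2 - m

/-- The shift map `(S, T) ↦ ({0} ∪ (S+1), {0} ∪ (T+1))`. -/
def shiftX (p : Finset ℕ × Finset ℕ) : Finset ℕ × Finset ℕ :=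
  (insert 0 (p.1.image (· + 1)), insert 0 (p.2.image (· + 1)))

/-- The sum of a finite set of naturals is at least `0 + 1 + ⋯ + (|A| - 1)`. -/
theorem card_mul_card_le_two_mul_sum_add_card (A : Finset ℕ) :
    A.card * A.card ≤ 2 * (∑ x ∈ A, x) + A.card := by
  induction A using Finset.induction_on_max with
  | empty => simp
  | insert a s hs ih =>
    have ha : a ∉ s := fun h => lt_irrefl a (hs a h)
    have hc : s.card ≤ a := by
      have h : s ⊆ Finset.range a := fun x hx => Finset.mem_range.2 (hs x hx)
      simpa using Finset.card_le_card h
    rw [Finset.card_insert_of_notMem ha, Finset.sum_insert ha]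
    nlinarith

/-- A stronger lower bound for a finite set of positive naturals. -/
theorem card_mul_card_add_card_le_two_mul_sum {A : Finset ℕ} (h : 0 ∉ A) :
    A.card * A.card + A.card ≤ 2 * ∑ x ∈ A, x := by
  have key := card_mul_card_le_two_mul_sum_add_card (insert 0 A)
  rw [Finset.card_insert_of_notMem h, Finset.sum_insert h] at key
  nlinarith

theorem card_insert_zero_image_succ (A : Finset ℕ) :
    (insert 0 (A.image (· + 1))).card = A.card + 1 := by
  rw [Finset.card_insert_of_notMem (by simp),
    Finset.card_image_of_injective _ (add_left_injective 1)]

theorem sum_insert_zero_image_succ (A : Finset ℕ) :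
    ∑ x ∈ insert 0 (A.image (· + 1)), x = ∑ x ∈ A, x + A.card := by
  rw [Finset.sum_insert (by simp), Finset.sum_image (add_left_injective 1).injOn]
  simp [Finset.sum_add_distrib]

theorem insert_zero_image_succ_injective :
    Function.Injective fun A : Finset ℕ => insert 0 (A.image (· + 1)) := by
  intro A B h
  ext x
  simpa using Finset.ext_iff.1 h (x + 1)

theorem exists_insert_zero_image_succ_eq {A : Finset ℕ} (h : 0 ∈ A) :
    ∃ B : Finset ℕ, insert 0 (B.image (· + 1)) = A := by
  refine ⟨(A.erase 0).image (· - 1), ?_⟩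
  have hid : ((A.erase 0).image (· - 1)).image (· + 1) = A.erase 0 := by
    rw [Finset.image_image]
    conv_rhs => rw [← Finset.image_id (s := A.erase 0)]
    refine Finset.image_congr fun x hx => ?_
    have : x ≠ 0 := (Finset.mem_erase.1 hx).1
    simp only [Function.comp, id]
    omega
  rw [hid, Finset.insert_erase h]

theorem shiftX_injective : Function.Injective shiftX := by
  rintro ⟨S, T⟩ ⟨S', T'⟩ h
  exact Prod.ext (insert_zero_image_succ_injective (congrArg Prod.fst h))
    (insert_zero_image_succ_injective (congrArg Prod.snd h))

theorem xnmMem_shiftX_iff (n m : ℕ) (p : Finset ℕ × Finset ℕ) :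
    XnmMem n (m + 1) (shiftX p) ↔ XnmMem n m p := by
  simp only [XnmMem, shiftX, card_insert_zero_image_succ, sum_insert_zero_image_succ,
    Nat.add_right_cancel_iff]
  refine and_congr (insert_zero_image_succ_injective.ne_iff) (and_congr_right fun h₁ =>
    and_congr_right fun h₂ => ?_)
  rw [h₁, h₂]
  have h₃ : m ≤ m ^ 2 := Nat.le_self_pow two_ne_zero m
  have h₄ : (m + 1) ^ 2 = m ^ 2 + 2 * m + 1 := by ring
  omega

theorem XnmMem.zero_mem {n m : ℕ} (hm : n ≤ m) {p : Finset ℕ × Finset ℕ}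
    (hp : XnmMem n (m + 1) p) : 0 ∈ p.1 ∧ 0 ∈ p.2 := by
  obtain ⟨-, h₁, h₂, hsum⟩ := hp
  have h₃ : (m + 1) ^ 2 = (m + 1) * (m + 1) := sq _
  have hS := card_mul_card_le_two_mul_sum_add_card p.1
  have hT := card_mul_card_le_two_mul_sum_add_card p.2
  rw [h₁] at hS
  rw [h₂] at hT
  constructor
  · by_contra h
    have hS' := card_mul_card_add_card_le_two_mul_sum h
    rw [h₁] at hS'
    omega
  · by_contra h
    have hT' := card_mul_card_add_card_le_two_mul_sum h
    rw [h₂] at hT'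
    omega

/-- If `m ≥ n`, then every `(S, T) ∈ X_n^{m+1}` satisfies `0 ∈ S` and `0 ∈ T`, and consequently
the shift map `X_n^m → X_n^{m+1}` is a bijection. -/
theorem stmt11 (n m : ℕ) (hn : 1 ≤ n) (hm : n ≤ m) :
    (∀ p : Finset ℕ × Finset ℕ, XnmMem n (m + 1) p → 0 ∈ p.1 ∧ 0 ∈ p.2) ∧
      Set.BijOn shiftX {p | XnmMem n m p} {p | XnmMem n (m + 1) p} := by
  refine ⟨fun p hp => hp.zero_mem hm, fun p hp => (xnmMem_shiftX_iff n m p).2 hp,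
    shiftX_injective.injOn, ?_⟩
  rintro ⟨S, T⟩ hp
  obtain ⟨hS, hT⟩ := XnmMem.zero_mem hm hp
  obtain ⟨S', rfl⟩ := exists_insert_zero_image_succ_eq hS
  obtain ⟨T', rfl⟩ := exists_insert_zero_image_succ_eq hT
  exact ⟨(S', T'), (xnmMem_shiftX_iff n m (S', T')).1 hp, rfl⟩
end

section
/- If m ≥ n, then every (M, N) ∈ X̄_n^{m+1} satisfies 0 ∈ N (hence 0 ∉ M), and consequently the shift map X̄_n^m → X̄_n^{m+1} is a bijection. -/
/-- Membership in the set `X̄_n^m`: ordered pairs `(M, N)` of disjoint finite subsets of `ℕ`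
with `M ≠ ∅`, `|M| + 2|N| = 2m` and `Σ_{x∈M} x + 2·Σ_{x∈N} x = n + m² − m`. -/
def XbarMem (n m : ℕ) (p : Finset ℕ × Finset ℕ) : Prop :=
  Disjoint p.1 p.2 ∧ p.1 ≠ ∅ ∧ p.1.card + 2 * p.2.card = 2 * m ∧
    (∑ x ∈ p.1, x) + 2 * (∑ x ∈ p.2, x) = n + m ^ 2 - m

/-- The shift map `(M, N) ↦ (M+1, {0} ∪ (N+1))`. -/
def shiftXbar (p : Finset ℕ × Finset ℕ) : Finset ℕ × Finset ℕ :=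
  (p.1.image (· + 1), insert 0 (p.2.image (· + 1)))

theorem sum_shifted (s : Finset ℕ) : ∑ x ∈ s.image (· + 1), x = ∑ x ∈ s, x + s.card := by
  rw [Finset.sum_image (add_left_injective 1).injOn, Finset.sum_add_distrib]
  simp

theorem sum_shiftXbar_snd (s : Finset ℕ) :
    ∑ x ∈ insert 0 (s.image (· + 1)), x = ∑ x ∈ s, x + s.card := by
  rw [Finset.sum_insert (by simp), sum_shifted, zero_add]

theorem card_shiftXbar_snd (s : Finset ℕ) :
    (insert 0 (s.image (· + 1))).card = s.card + 1 := by
  rw [Finset.card_insert_of_notMem (by simp),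
    Finset.card_image_of_injective _ (add_left_injective 1)]

theorem xbarMem_shiftXbar_iff (n m : ℕ) (p : Finset ℕ × Finset ℕ) :
    XbarMem n (m + 1) (shiftXbar p) ↔ XbarMem n m p := by
  obtain ⟨M, N⟩ := p
  have hdisj : Disjoint (M.image (· + 1)) (insert 0 (N.image (· + 1))) ↔ Disjoint M N := by
    rw [Finset.disjoint_insert_right, Finset.disjoint_image (add_left_injective 1)]
    simp
  have hsq : n + (m + 1) ^ 2 - (m + 1) = n + m ^ 2 - m + 2 * m := by
    have h : m ≤ m ^ 2 := Nat.le_self_pow two_ne_zero m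
    have h' : (m + 1) ^ 2 = m ^ 2 + 2 * m + 1 := by ring
    omega
  simp only [XbarMem, shiftXbar, hdisj, sum_shiftXbar_snd, card_shiftXbar_snd, sum_shifted,
    Finset.card_image_of_injective _ (add_left_injective 1), hsq, ne_eq, Finset.image_eq_empty]
  refine and_congr_right fun _ => and_congr_right fun _ => ?_
  constructor <;> rintro ⟨h₁, h₂⟩ <;> constructor <;> omega

theorem image_succ_image_pred {s : Finset ℕ} (hs : 0 ∉ s) :
    (s.image Nat.pred).image (· + 1) = s := by
  rw [Finset.image_image]
  conv_rhs => rw [← Finset.image_id (s := s)]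
  refine Finset.image_congr fun x hx => ?_
  exact Nat.succ_pred_eq_of_ne_zero (ne_of_mem_of_not_mem hx hs)

theorem shiftXbar_injective : Function.Injective shiftXbar := by
  rintro ⟨M, N⟩ ⟨M', N'⟩ h
  obtain ⟨h₁, h₂⟩ := Prod.mk.inj h
  have hN := congrArg (Finset.erase · 0) h₂
  simp only [Finset.erase_insert_eq_erase] at hN
  rw [Finset.erase_eq_of_notMem (by simp), Finset.erase_eq_of_notMem (by simp)] at hN
  have hinj := Finset.image_injective (add_left_injective (1 : ℕ))
  exact Prod.ext (hinj h₁) (hinj hN)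

theorem exists_shiftXbar_eq {p : Finset ℕ × Finset ℕ} (hM : 0 ∉ p.1) (hN : 0 ∈ p.2) :
    ∃ q, shiftXbar q = p := by
  refine ⟨(p.1.image Nat.pred, (p.2.erase 0).image Nat.pred), Prod.ext ?_ ?_⟩
  · exact image_succ_image_pred hM
  · simp only [shiftXbar]
    rw [image_succ_image_pred (by simp), Finset.insert_erase hN]

theorem two_mul_sum_tsub_le (s : Finset ℕ) (hs : 0 ∉ s) (k : ℕ) :
    2 * ∑ x ∈ s, (k - x) + k ≤ k ^ 2 := by
  have hle : ∑ x ∈ insert 0 s, (k - x) ≤ ∑ x ∈ Finset.range (k + 1), (k - x) := by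
    refine Finset.sum_le_sum_of_ne_zero fun x _ hx => ?_
    rw [Finset.mem_range]
    omega
  have hrefl : ∑ x ∈ Finset.range (k + 1), (k - x) = ∑ x ∈ Finset.range (k + 1), x := by
    simpa using Finset.sum_range_reflect (fun x => x) (k + 1)
  have hgauss := Finset.sum_range_id_mul_two (k + 1)
  rw [Finset.sum_insert hs] at hle
  simp only [Nat.add_sub_cancel] at hgauss
  have : (k + 1) * k = k ^ 2 + k := by ring
  omega

theorem card_mul_le_sum_add_sum_tsub (s : Finset ℕ) (k : ℕ) :
    s.card * k ≤ ∑ x ∈ s, x + ∑ x ∈ s, (k - x) := by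
  rw [← Finset.sum_add_distrib, ← smul_eq_mul]
  exact Finset.card_nsmul_le_sum _ _ _ fun x _ => by omega

/-- If `0 ∉ N`, the weighted sum of a pair of weighted size `2k` is at least `k²`. -/
theorem sq_le_weighted_sum {M N : Finset ℕ} {k : ℕ} (hd : Disjoint M N)
    (hc : M.card + 2 * N.card = 2 * k) (h0 : 0 ∉ N) :
    k ^ 2 ≤ ∑ x ∈ M, x + 2 * ∑ x ∈ N, x := by
  have hM := card_mul_le_sum_add_sum_tsub M k
  have hN := card_mul_le_sum_add_sum_tsub N k
  have hcard : M.card * k + 2 * (N.card * k) = 2 * k ^ 2 := by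
    rw [← mul_assoc, ← add_mul, hc]
    ring
  have hu := two_mul_sum_tsub_le (M.erase 0 ∪ N) (by simp [h0]) k
  rw [Finset.sum_union (hd.mono_left (Finset.erase_subset _ _))] at hu
  have herase : ∑ x ∈ M, (k - x) ≤ ∑ x ∈ M.erase 0, (k - x) + k := by
    by_cases h : 0 ∈ M
    · rw [← Finset.sum_erase_add _ _ h, Nat.sub_zero]
    · rw [Finset.erase_eq_of_notMem h]
      exact Nat.le_add_right _ _
  omega

theorem XbarMem.zero_mem_snd {n m : ℕ} (hm : n ≤ m) {p : Finset ℕ × Finset ℕ}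
    (hp : XbarMem n (m + 1) p) : 0 ∈ p.2 := by
  obtain ⟨hd, -, hc, hsum⟩ := hp
  by_contra h0
  have h := sq_le_weighted_sum hd hc h0
  have : 0 < (m + 1) ^ 2 := by positivity
  omega

/-- If `m ≥ n`, then every `(M, N) ∈ X̄_n^{m+1}` satisfies `0 ∈ N` (hence `0 ∉ M`), and
consequently the shift map `X̄_n^m → X̄_n^{m+1}` is a bijection. -/
theorem stmt12 (n m : ℕ) (hn : 1 ≤ n) (hm : n ≤ m) :
    (∀ p : Finset ℕ × Finset ℕ, XbarMem n (m + 1) p → 0 ∈ p.2 ∧ 0 ∉ p.1) ∧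
      Set.BijOn shiftXbar {p | XbarMem n m p} {p | XbarMem n (m + 1) p} := by
  have hzero : ∀ p : Finset ℕ × Finset ℕ, XbarMem n (m + 1) p → 0 ∈ p.2 ∧ 0 ∉ p.1 :=
    fun p hp => ⟨hp.zero_mem_snd hm,
      Finset.disjoint_right.mp hp.1 (hp.zero_mem_snd hm)⟩
  refine ⟨hzero, fun p hp => (xbarMem_shiftXbar_iff n m p).mpr hp,
    shiftXbar_injective.injOn, fun p hp => ?_⟩
  obtain ⟨q, rfl⟩ := exists_shiftXbar_eq (hzero p hp).2 (hzero p hp).1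
  exact ⟨q, (xbarMem_shiftXbar_iff n m q).mp hp, rfl⟩
end

section
/- The map ζ : X_n^m → X̄_n^m sending (S, T) to (S△T, S∩T) (symmetric difference and intersection) is well defined and surjective, and for each (M, N) ∈ X̄_n^m the assignment H ↦ (N ∪ H, N ∪ (M − H)) is a bijection from 𝒱_M onto the fiber ζ⁻¹(M, N). -/
open scoped symmDiff

theorem Finset.sum_symmDiff_add_two_mul_sum_inter {α R : Type*} [DecidableEq α]
    [CommSemiring R] (S T : Finset α) (f : α → R) :
    ∑ x ∈ S ∆ T, f x + 2 * ∑ x ∈ S ∩ T, f x = ∑ x ∈ S, f x + ∑ x ∈ T, f x := by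
  have hd : Disjoint (S \ T) (T \ S) := disjoint_sdiff_sdiff
  have hS := Finset.sum_inter_add_sum_sdiff S T f
  have hT := Finset.sum_inter_add_sum_sdiff T S f
  rw [Finset.inter_comm T S] at hT
  rw [← hS, ← hT, symmDiff_def, Finset.sup_eq_union, Finset.sum_union hd]
  ring

theorem Finset.card_symmDiff_add_two_mul_card_inter {α : Type*} [DecidableEq α]
    (S T : Finset α) : (S ∆ T).card + 2 * (S ∩ T).card = S.card + T.card := by
  simpa using Finset.sum_symmDiff_add_two_mul_sum_inter S T (fun _ => (1 : ℕ))

theorem Finset.union_symmDiff_union_sdiff {α : Type*} [DecidableEq α] {M N H : Finset α}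
    (hd : Disjoint M N) (hH : H ⊆ M) : (N ∪ H) ∆ (N ∪ (M \ H)) = M := by
  ext x
  have h1 : x ∈ M → x ∉ N := fun h => Finset.disjoint_left.mp hd h
  have h2 : x ∈ H → x ∈ M := fun h => hH h
  simp only [Finset.mem_symmDiff, Finset.mem_union, Finset.mem_sdiff]
  tauto

theorem Finset.union_inter_union_sdiff {α : Type*} [DecidableEq α] (M N H : Finset α) :
    (N ∪ H) ∩ (N ∪ (M \ H)) = N := by
  ext x
  simp only [Finset.mem_inter, Finset.mem_union, Finset.mem_sdiff]
  tauto

theorem XnmMem.xbarMem {n m : ℕ} {p : Finset ℕ × Finset ℕ} (h : XnmMem n m p) :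
    XbarMem n m (p.1 ∆ p.2, p.1 ∩ p.2) := by
  obtain ⟨hne, h1, h2, hs⟩ := h
  refine ⟨disjoint_symmDiff_inf p.1 p.2, fun h => hne (symmDiff_eq_bot.mp h), ?_, ?_⟩
  · rw [Finset.card_symmDiff_add_two_mul_card_inter]
    omega
  · rw [Finset.sum_symmDiff_add_two_mul_sum_inter, hs]

theorem XbarMem.xnmMem_union {n m : ℕ} {M N H : Finset ℕ} (h : XbarMem n m (M, N))
    (hH : H ⊆ M) (hc : 2 * H.card = M.card) : XnmMem n m (N ∪ H, N ∪ (M \ H)) := by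
  obtain ⟨hd, hne, hcard, hs⟩ := h
  dsimp only at hd hne hcard hs
  have hM := Finset.union_symmDiff_union_sdiff hd hH
  have hN := Finset.union_inter_union_sdiff M N H
  have hdH : Disjoint N H := (hd.mono_left hH).symm
  have hdH' : Disjoint N (M \ H) := (hd.mono_left Finset.sdiff_subset).symm
  have hcs := Finset.card_sdiff_of_subset hH
  refine ⟨fun heq => hne ?_, ?_, ?_, ?_⟩
  · rw [← hM]
    exact symmDiff_eq_bot.mpr heq
  · rw [Finset.card_union_of_disjoint hdH]
    omega
  · rw [Finset.card_union_of_disjoint hdH']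
    omega
  · rw [← Finset.sum_symmDiff_add_two_mul_sum_inter, hM, hN, hs]

/-- The map `ζ : X_n^m → X̄_n^m`, `(S, T) ↦ (S △ T, S ∩ T)`, is well defined and surjective, and
for each `(M, N) ∈ X̄_n^m` the assignment `H ↦ (N ∪ H, N ∪ (M − H))` is a bijection from `𝒱_M`
(the subsets of `M` of cardinality `|M|/2`) onto the fiber `ζ⁻¹(M, N)`. -/
theorem stmt13 (n m : ℕ) (hn : 1 ≤ n) :
    (∀ p : Finset ℕ × Finset ℕ, XnmMem n m p → XbarMem n m (p.1 ∆ p.2, p.1 ∩ p.2)) ∧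
      (∀ q : Finset ℕ × Finset ℕ, XbarMem n m q →
        ∃ p : Finset ℕ × Finset ℕ, XnmMem n m p ∧ (p.1 ∆ p.2, p.1 ∩ p.2) = q) ∧
      (∀ M N : Finset ℕ, XbarMem n m (M, N) →
        Set.BijOn (fun H : Finset ℕ => (N ∪ H, N ∪ (M \ H)))
          {H : Finset ℕ | H ⊆ M ∧ 2 * H.card = M.card}
          {p : Finset ℕ × Finset ℕ | XnmMem n m p ∧ p.1 ∆ p.2 = M ∧ p.1 ∩ p.2 = N}) := by
  refine ⟨fun p hp => hp.xbarMem, ?_, ?_⟩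
  · rintro ⟨M, N⟩ hq
    have hcard : M.card + 2 * N.card = 2 * m := hq.2.2.1
    obtain ⟨H, hH, hc⟩ := Finset.exists_subset_card_eq (s := M) (n := M.card / 2) (by omega)
    exact ⟨(N ∪ H, N ∪ (M \ H)), hq.xnmMem_union hH (by omega),
      Prod.ext (Finset.union_symmDiff_union_sdiff hq.1 hH)
        (Finset.union_inter_union_sdiff M N H)⟩
  · intro M N hq
    have hd : Disjoint M N := hq.1
    refine ⟨?_, ?_, ?_⟩
    · rintro H ⟨hH, hc⟩
      exact ⟨hq.xnmMem_union hH hc, Finset.union_symmDiff_union_sdiff hd hH,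
        Finset.union_inter_union_sdiff M N H⟩
    · rintro H ⟨hH, -⟩ K ⟨hK, -⟩ heq
      have h : N ∪ H = N ∪ K := congrArg Prod.fst heq
      rw [← Finset.union_sdiff_cancel_left (hd.mono_left hH).symm, h,
        Finset.union_sdiff_cancel_left (hd.mono_left hK).symm]
    · rintro ⟨S, T⟩ ⟨⟨-, hS, hT, -⟩, rfl, rfl⟩
      dsimp only at hS hT ⊢
      have hcard := Finset.card_symmDiff_add_two_mul_card_inter S T
      have hST := Finset.card_sdiff_add_card_inter S T
      refine ⟨S \ T, ⟨le_sup_left, by omega⟩, Prod.ext ?_ ?_⟩ <;>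
      · ext x
        simp only [Finset.mem_symmDiff, Finset.mem_union, Finset.mem_inter, Finset.mem_sdiff]
        tauto
end

section
/- Every simple ℚ̄[H]-module E is isomorphic to E′ ⊗ E″, where E′ is a ℚ̄[H]-module defined over ℚ and E″ is a one-dimensional ℚ̄[H]-module. -/
open CategoryTheory MonoidalCategory

/-- The automorphism of the `𝔽₂`-vector space with basis `{a,b,c,d}` (written multiplicatively)
obtained by permuting the basis by `σ`. -/
def flipAut (σ : Equiv.Perm (Fin 4)) : MulAut (Multiplicative (Fin 4 → ZMod 2)) where
  toFun f := Multiplicative.ofAdd (Multiplicative.toAdd f ∘ σ.symm)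
  invFun f := Multiplicative.ofAdd (Multiplicative.toAdd f ∘ σ)
  left_inv f := Multiplicative.toAdd.injective (by funext x; simp)
  right_inv f := Multiplicative.toAdd.injective (by funext x; simp)
  map_mul' f g := rfl

/-- The permutation action of `Perm (Fin 4)` on the `𝔽₂`-vector space with basis `{a,b,c,d}`. -/
def permHom : Equiv.Perm (Fin 4) →* MulAut (Multiplicative (Fin 4 → ZMod 2)) where
  toFun := flipAut
  map_one' := by
    ext f
    rfl
  map_mul' σ τ := by
    ext f
    rfl

/-- The action of the alternating group `Γ = A₄` (on the four letters `a,b,c,d`) on the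
`𝔽₂`-vector space with basis `{a,b,c,d}`. -/
def thetaA4 : ↥(alternatingGroup (Fin 4)) →* MulAut (Multiplicative (Fin 4 → ZMod 2)) :=
  permHom.comp (alternatingGroup (Fin 4)).subtype

theorem FDRep.span_orbit_eq_top {k : Type} [Field k] {G : Type} [Group G] (E : FDRep k G)
    [Simple E] {v : E} (hv : v ≠ 0) :
    Submodule.span k (Set.range fun g => E.ρ g v) = ⊤ := by
  let p : Submodule k E := Submodule.span k (Set.range fun g => E.ρ g v)
  have hp : ∀ g, ∀ x ∈ p, E.ρ g x ∈ p := by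
    intro g x hx
    refine Submodule.span_le (p := p.comap (E.ρ g)).2 ?_ hx
    rintro _ ⟨g', rfl⟩
    refine Submodule.subset_span ⟨g * g', ?_⟩
    simp
  let σ : Subrepresentation E.ρ := ⟨p, hp⟩
  let f : FDRep.of σ.toRepresentation ⟶ E :=
    ⟨FGModuleCat.ofHom p.subtype, fun g => by ext x; rfl⟩
  have hinj : Function.Injective f.hom := p.injective_subtype
  have : Mono f := by
    apply (forget (FDRep k G)).mono_of_mono_map
    exact (mono_iff_injective _).2 hinj
  have hvp : v ∈ p := Submodule.subset_span ⟨1, by simp⟩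
  have hf : f ≠ 0 := by
    intro h
    apply hv
    have : f.hom (⟨v, hvp⟩ : p) = 0 := by rw [h]; rfl
    exact this
  have := isIso_of_mono_of_nonzero hf
  rw [eq_top_iff]
  intro x _
  have h1 : (inv f ≫ f).hom x = x := by rw [IsIso.inv_hom_id]; rfl
  rw [← h1]
  exact ((inv f).hom x : p).2

theorem exists_fdRep_character_eq {k : Type} [Field k] [Algebra ℚ k] {G : Type} [Group G]
    {E : Type} [AddCommGroup E] [Module k E] (ρ : Representation k G E)
    {ι : Type} [Finite ι] (b : Module.Basis ι k E)
    (h : ∀ g i j, b.repr (ρ g (b j)) i ∈ (algebraMap ℚ k).range) :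
    ∃ F : FDRep ℚ G, ∀ g, LinearMap.trace k E (ρ g) = algebraMap ℚ k (F.character g) := by
  classical
  have := Fintype.ofFinite ι
  choose m hm using h
  let M : G → Matrix ι ι ℚ := fun g => Matrix.of (m g)
  have hM : ∀ g, (algebraMap ℚ k).mapMatrix (M g) = LinearMap.toMatrix b b (ρ g) := by
    intro g
    ext i j
    simp [M, hm, LinearMap.toMatrix_apply]
  have hinj : Function.Injective ((algebraMap ℚ k).mapMatrix (m := ι)) :=
    Matrix.map_injective (algebraMap ℚ k).injective
  let R : G →* Matrix ι ι ℚ :=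
    { toFun := M
      map_one' := hinj (by rw [hM]; simp [LinearMap.toMatrix_one])
      map_mul' := fun x y => hinj (by
        rw [map_mul, hM, hM, hM, map_mul, LinearMap.toMatrix_mul]) }
  let τ : Representation ℚ G (ι → ℚ) :=
    (Matrix.toLinAlgEquiv' : Matrix ι ι ℚ ≃ₐ[ℚ] _).toMonoidHom.comp R
  refine ⟨FDRep.of τ, fun g => ?_⟩
  have h1 : (FDRep.of τ).character g = (M g).trace := by
    change LinearMap.trace ℚ (ι → ℚ) (Matrix.toLin' (M g)) = _
    simp
  rw [h1, LinearMap.trace_eq_matrix_trace k b, ← hM]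
  simp [Matrix.trace]

/-- A representation generated by a vector `u` whose translates are either `±u` or killed by an
operator fixing `u` acts by signed permutations on a basis of translates of `u`; in particular
its character is that of a rational representation. -/
theorem exists_fdRep_character_eq_of_signed_stabilizer {k : Type} [Field k] [Algebra ℚ k]
    {G : Type} [Group G] {E : Type} [AddCommGroup E] [Module k E] [FiniteDimensional k E]
    (ρ : Representation k G E) {u : E} (hu : u ≠ 0)
    (hspan : Submodule.span k (Set.range fun g => ρ g u) = ⊤)
    (P : E →ₗ[k] E) (hP : P u = u)
    (h : ∀ g, ρ g u = u ∨ ρ g u = -u ∨ P (ρ g u) = 0) :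
    ∃ F : FDRep ℚ G, ∀ g, LinearMap.trace k E (ρ g) = algebraMap ℚ k (F.character g) := by
  classical
  have hinv : ∀ {g} {x y : E}, ρ g x = y → ρ g⁻¹ y = x := by
    rintro g x y rfl
    simp [← Module.End.mul_apply, ← map_mul]
  let K : Subgroup G :=
    { carrier := {g | ρ g u = u ∨ ρ g u = -u}
      one_mem' := by simp
      mul_mem' := by
        rintro x y (hx | hx) (hy | hy) <;> simp [hx, hy]
      inv_mem' := by
        rintro x (hx | hx)
        · exact Or.inl (hinv hx)
        · right
          have := hinv hx
          rw [map_neg] at this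
          exact neg_eq_iff_eq_neg.1 this }
  let c : G ⧸ K → E := fun q => ρ q.out u
  have hc : ∀ g : G, ρ g u = c g ∨ ρ g u = -c g := by
    intro g
    obtain ⟨κ, hκ⟩ := QuotientGroup.mk_out_eq_mul K g
    have : c g = ρ g (ρ κ u) := by simp [c, hκ]
    rcases κ.2 with h | h <;> rw [this, h] <;> simp
  have hli : LinearIndependent k c := by
    rw [linearIndependent_iff']
    intro s a ha q hq
    have h1 := congrArg (fun x => P (ρ q.out⁻¹ x)) ha
    simp only [map_sum, map_smul, map_zero] at h1
    rw [Finset.sum_eq_single q] at h1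
    · have : ρ q.out⁻¹ (c q) = u := hinv rfl
      rw [this, hP] at h1
      exact (smul_eq_zero.1 h1).resolve_right hu
    · intro r _ hr
      have h2 : ρ q.out⁻¹ (c r) = ρ (q.out⁻¹ * r.out) u := by simp [c]
      have h3 : q.out⁻¹ * r.out ∉ K := by
        intro hK
        apply hr
        rw [← QuotientGroup.eq] at hK
        simpa using hK.symm
      rw [h2]
      rcases h (q.out⁻¹ * r.out) with h4 | h4 | h4
      · exact absurd (Or.inl h4) h3
      · exact absurd (Or.inr h4) h3
      · rw [h4, smul_zero]
    · exact fun h => absurd hq h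
  have hsp : ⊤ ≤ Submodule.span k (Set.range c) := by
    rw [← hspan, Submodule.span_le]
    rintro _ ⟨g, rfl⟩
    have : c g ∈ Submodule.span k (Set.range c) := Submodule.subset_span ⟨_, rfl⟩
    rcases hc g with h | h <;> simp only [h]
    · exact this
    · exact neg_mem this
  let b := Module.Basis.mk hli hsp
  have := Module.Finite.finite_basis b
  refine exists_fdRep_character_eq ρ b fun g i j => ?_
  have hb : ∀ j, b j = c j := fun j => by simp [b]
  have h1 : ρ g (b j) = ρ (g * j.out) u := by simp [hb, c]
  have h2 : ∀ j, b.repr (c j) i ∈ (algebraMap ℚ k).range := by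
    intro j
    rw [← hb, Module.Basis.repr_self, Finsupp.single_apply]
    split_ifs <;> simp
  rw [h1]
  rcases hc (g * j.out) with h | h <;> rw [h]
  · exact h2 _
  · rw [map_neg, Finsupp.neg_apply]
    exact neg_mem (h2 _)

theorem FDRep.exists_iso_tensor_twist {k : Type} [Field k] {G : Type} [Group G] (E : FDRep k G)
    (lam : G →* kˣ) (ρ' : Representation k G E) (h : ∀ g v, lam g • ρ' g v = E.ρ g v) :
    ∃ E'' : FDRep k G, Module.finrank k E'' = 1 ∧ Nonempty (E ≅ FDRep.of ρ' ⊗ E'') := by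
  let τ : Representation k G k :=
    (Algebra.lmul k k : k →* Module.End k k).comp ((Units.coeHom k).comp lam)
  refine ⟨FDRep.of τ, Module.finrank_self k, ⟨?_⟩⟩
  refine Action.mkIso (LinearEquiv.toFGModuleCatIso (TensorProduct.rid k E).symm) fun g => ?_
  ext x
  change TensorProduct.tmul k (E.ρ g x) (1 : k) = TensorProduct.tmul k (ρ' g x) ((lam g : k) * 1)
  rw [← h]
  rw [← smul_eq_mul, TensorProduct.tmul_smul, TensorProduct.smul_tmul']
  rfl

/-- The exponent of the cubic character of `A₄`, read off from the conjugate of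
`(0 1)(2 3)` by `s`. -/
def cubicExponent (s : alternatingGroup (Fin 4)) : ZMod 3 :=
  1 - ((s.1 ((Equiv.swap 0 1 * Equiv.swap 2 3 : Equiv.Perm (Fin 4)) (s.1.symm 0)) : ℕ) : ZMod 3)

theorem cubicExponent_mul : ∀ s t : alternatingGroup (Fin 4),
    cubicExponent (s * t) = cubicExponent s + cubicExponent t := by
  decide +kernel

set_option synthInstance.maxHeartbeats 200000 in
theorem stabilizer_cyclic_of_not_const : ∀ ε : Fin 4 → ℤˣ, (∀ i, ε i = ε 0) ∨
    ∃ t : alternatingGroup (Fin 4), (∀ i, ε (t.1 i) = ε i) ∧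
      ((t * t = 1 ∧ ∀ s : alternatingGroup (Fin 4), (∀ i, ε (s.1 i) = ε i) →
          s = 1 ∨ s = t) ∨
        (t ^ 3 = 1 ∧ ∀ s : alternatingGroup (Fin 4), (∀ i, ε (s.1 i) = ε i) →
          s = t ^ (cubicExponent s).val)) := by
  decide +kernel

theorem exists_kleinFour_mul_pow : ∃ c : alternatingGroup (Fin 4), c ^ 3 = 1 ∧
    ∀ s : alternatingGroup (Fin 4),
      ∃ n : alternatingGroup (Fin 4), n * n = 1 ∧ s = n * c ^ (cubicExponent s).val := by
  decide +kernel

set_option synthInstance.maxHeartbeats 200000 in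
set_option synthInstance.maxSize 1000 in
theorem exists_generators_kleinFour : ∃ x y : alternatingGroup (Fin 4),
    x * x = 1 ∧ y * y = 1 ∧ x * y = y * x ∧ x ≠ 1 ∧ y ≠ 1 ∧ x * y ≠ 1 ∧
    ∀ s : alternatingGroup (Fin 4), s * s = 1 → s = 1 ∨ s = x ∨ s = y ∨ s = x * y := by
  decide +kernel

set_option synthInstance.maxHeartbeats 200000 in
theorem conj_ne_of_not_involutive : ∀ s n : alternatingGroup (Fin 4),
    n * n = 1 → n ≠ 1 → s * s ≠ 1 → s⁻¹ * n * s ≠ n := by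
  decide +kernel

/-- The cubic character of `A₄` with parameter a cube root of unity `μ`. -/
def cubicChar {k : Type} [Field k] (μ : kˣ) (hμ : μ ^ 3 = 1) : alternatingGroup (Fin 4) →* kˣ where
  toFun s := μ ^ (cubicExponent s).val
  map_one' := by
    rw [show cubicExponent 1 = 0 by decide]
    simp
  map_mul' s t := by
    rw [cubicExponent_mul, ← pow_add, ZMod.val_add]
    exact (pow_eq_pow_mod _ hμ).symm

section

variable {k : Type} [Field k] {E : Type} [AddCommGroup E] [Module k E]

/-- The joint eigenspace of the operators `T i`, `i ∈ s`, for the signs `ε i`. -/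
def signedEigenspace {ι : Type} (T : ι → Module.End k E) (ε : ι → ℤˣ) (s : Finset ι) :
    Submodule k E where
  carrier := {v | ∀ i ∈ s, T i v = ε i • v}
  zero_mem' := by simp
  add_mem' hv hw i hi := by rw [map_add, hv i hi, hw i hi, smul_add]
  smul_mem' c v hv i hi := by rw [map_smul, hv i hi, smul_comm]

theorem map_units_smul (C : Module.End k E) (η : ℤˣ) (v : E) : C (η • v) = η • C v := by
  rcases Int.units_eq_one_or η with rfl | rfl <;> simp

theorem exists_eigenvector_mem [IsAlgClosed k] [FiniteDimensional k E] (p : Submodule k E)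
    (hp : ∃ v ∈ p, v ≠ 0) (C : Module.End k E) (hC : ∀ v ∈ p, C v ∈ p) :
    ∃ v ∈ p, v ≠ 0 ∧ ∃ μ : k, C v = μ • v := by
  obtain ⟨v, hv, hv0⟩ := hp
  have : Nontrivial p := ⟨⟨⟨v, hv⟩, 0, by simpa [Subtype.ext_iff] using hv0⟩⟩
  obtain ⟨μ, hμ⟩ := Module.End.exists_eigenvalue (C.restrict hC)
  obtain ⟨w, hw⟩ := hμ.exists_hasEigenvector
  refine ⟨w, w.2, by simpa using hw.2, μ, ?_⟩
  simpa [Subtype.ext_iff] using hw.apply_eq_smul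

theorem pow_apply_of_eigenvector {C : Module.End k E} {v : E} {μ : k} (h : C v = μ • v) (n : ℕ) :
    (C ^ n) v = μ ^ n • v := by
  induction n with
  | zero => simp
  | succ n ih => rw [pow_succ', Module.End.mul_apply, ih, map_smul, h, smul_smul, pow_succ]

theorem eigenvalue_pow_eq_one {C : Module.End k E} {v : E} (hv : v ≠ 0) {μ : k} (h : C v = μ • v)
    {n : ℕ} (hC : C ^ n = 1) : μ ^ n = 1 := by
  have h1 := pow_apply_of_eigenvector h n
  rw [hC, Module.End.one_apply] at h1
  refine smul_left_injective k hv ?_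
  simpa using h1.symm

theorem exists_signed_eigenvector_mem [IsAlgClosed k] [FiniteDimensional k E] (p : Submodule k E)
    (hp : ∃ v ∈ p, v ≠ 0) (C : Module.End k E) (hC : ∀ v ∈ p, C v ∈ p) (h2 : C * C = 1) :
    ∃ v ∈ p, v ≠ 0 ∧ ∃ η : ℤˣ, C v = η • v := by
  obtain ⟨v, hv, hv0, μ, hμ⟩ := exists_eigenvector_mem p hp C hC
  refine ⟨v, hv, hv0, ?_⟩
  have h1 : μ ^ 2 = 1 := eigenvalue_pow_eq_one hv0 hμ (by rw [pow_two, h2])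
  rcases mul_self_eq_one_iff.1 ((pow_two μ).symm.trans h1) with rfl | rfl
  · exact ⟨1, by simpa using hμ⟩
  · exact ⟨-1, by simpa using hμ⟩

theorem exists_common_signed_eigenvector [IsAlgClosed k] [FiniteDimensional k E]
    (p : Submodule k E) (hp : ∃ v ∈ p, v ≠ 0)
    {ι : Type} (T : ι → Module.End k E) (hTp : ∀ i, ∀ v ∈ p, T i v ∈ p)
    (hT : ∀ i, T i * T i = 1) (hcomm : ∀ i j, T i * T j = T j * T i) (s : Finset ι) :
    ∃ v ∈ p, v ≠ 0 ∧ ∃ ε : ι → ℤˣ, ∀ i ∈ s, T i v = ε i • v := by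
  classical
  induction s using Finset.induction_on with
  | empty =>
    obtain ⟨v, hv, hv0⟩ := hp
    exact ⟨v, hv, hv0, 1, by simp⟩
  | insert a s ha ih =>
    obtain ⟨v, hv, hv0, ε, hε⟩ := ih
    obtain ⟨w, hw, hw0, η, hη⟩ := exists_signed_eigenvector_mem
      (p ⊓ signedEigenspace T ε s) ⟨v, ⟨hv, hε⟩, hv0⟩ (T a)
      (fun v hv => ⟨hTp a v hv.1, fun i hi => by
        rw [← Module.End.mul_apply, hcomm, Module.End.mul_apply, hv.2 i hi, map_units_smul]⟩)
      (hT a)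
    refine ⟨w, hw.1, hw0, Function.update ε a η, fun i hi => ?_⟩
    by_cases hia : i = a
    · subst hia
      simpa using hη
    · rw [Function.update_of_ne hia]
      exact hw.2 i (Finset.mem_of_mem_insert_of_ne hi hia)

theorem exists_projector_signedEigenspace [CharZero k] (T : Fin 4 → Module.End k E)
    (ε : Fin 4 → ℤˣ) :
    ∃ P : Module.End k E, (∀ w, (∀ i, T i w = ε i • w) → P w = w) ∧
      ∀ (w : E) (δ : Fin 4 → ℤˣ), (∀ i, T i w = δ i • w) → (∃ i, δ i ≠ ε i) → P w = 0 := by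
  let Q : Fin 4 → Module.End k E := fun i => (2⁻¹ : k) • (1 + ε i • T i)
  have hQ : ∀ i (w : E) (δ : ℤˣ), T i w = δ • w → Q i w = if δ = ε i then w else 0 := by
    intro i w δ h
    have h2 : (2⁻¹ : k) • (w + w) = w := by
      rw [← two_smul k w, smul_smul]
      norm_num
    have h1 : Q i w = (2⁻¹ : k) • (w + ε i • T i w) := by
      rcases Int.units_eq_one_or (ε i) with h | h <;> simp [Q, h]
    rw [h1, h]
    rcases Int.units_eq_one_or (ε i) with h | h <;> rcases Int.units_eq_one_or δ with h' | h' <;>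
      simp [h, h', h2, -smul_add]
  refine ⟨Q 0 * Q 1 * Q 2 * Q 3, fun w hw => ?_, fun w δ hw ⟨i, hi⟩ => ?_⟩
  · have h : ∀ i, Q i w = w := fun i => by rw [hQ i w _ (hw i), if_pos rfl]
    simp only [Module.End.mul_apply, h]
  · let c : Fin 4 → k := fun i => if δ i = ε i then 1 else 0
    have h : ∀ i, Q i w = c i • w := fun i => by
      rw [hQ i w _ (hw i)]
      simp only [c]
      split_ifs <;> simp
    have hc : ∏ i, c i = 0 := Finset.prod_eq_zero (Finset.mem_univ i) (if_neg hi)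
    simp only [Module.End.mul_apply, h, map_smul, smul_smul]
    rw [Fin.prod_univ_four] at hc
    rw [show c 3 * (c 2 * (c 1 * c 0)) = c 0 * c 1 * c 2 * c 3 by ring, hc, zero_smul]

theorem exists_signed_stabilizer_of_not_const [CharZero k] [IsAlgClosed k] [FiniteDimensional k E]
    (S : alternatingGroup (Fin 4) →* Module.End k E) (T : Fin 4 → Module.End k E)
    (hST : ∀ s i, S s * T i = T (s.1 i) * S s) {ε : Fin 4 → ℤˣ}
    {v : E} (hv : ∀ i, T i v = ε i • v) (hv0 : v ≠ 0)
    {t : alternatingGroup (Fin 4)} (ht : ∀ i, ε (t.1 i) = ε i)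
    (h : (t * t = 1 ∧ ∀ s : alternatingGroup (Fin 4), (∀ i, ε (s.1 i) = ε i) → s = 1 ∨ s = t) ∨
      (t ^ 3 = 1 ∧ ∀ s : alternatingGroup (Fin 4), (∀ i, ε (s.1 i) = ε i) →
        s = t ^ (cubicExponent s).val)) :
    ∃ (χ : alternatingGroup (Fin 4) →* kˣ) (u : E) (P : Module.End k E) (ε : Fin 4 → ℤˣ),
      u ≠ 0 ∧ (∀ i, T i u = ε i • u) ∧ P u = u ∧
      ∀ s, S s u = χ s • u ∨ S s u = -(χ s • u) ∨ P (S s u) = 0 := by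
  obtain ⟨P, hP, hP'⟩ := exists_projector_signedEigenspace T ε
  have hTS : ∀ s i (w : E), (∀ i, T i w = ε i • w) → T (s.1 i) (S s w) = ε i • S s w := by
    intro s i w hw
    rw [← Module.End.mul_apply, ← hST, Module.End.mul_apply, hw, map_units_smul]
  have hPS : ∀ s (w : E), (∀ i, T i w = ε i • w) → ¬ (∀ i, ε (s.1 i) = ε i) → P (S s w) = 0 := by
    intro s w hw hs
    push Not at hs
    obtain ⟨i, hi⟩ := hs
    refine hP' (S s w) (fun j => ε (s.1.symm j)) (fun j => ?_) ⟨s.1 i, ?_⟩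
    · simpa using hTS s (s.1.symm j) w hw
    · simpa using hi.symm
  have hCp : ∀ w ∈ signedEigenspace T ε Finset.univ, S t w ∈ signedEigenspace T ε Finset.univ := by
    intro w hw i _
    have := hTS t (t.1.symm i) w (fun i => hw i (Finset.mem_univ i))
    rw [← ht] at this
    simpa using this
  rcases h with ⟨ht2, hs⟩ | ⟨ht3, hs⟩
  · obtain ⟨u, hu, hu0, η, hη⟩ := exists_signed_eigenvector_mem (signedEigenspace T ε Finset.univ)
      ⟨v, fun i _ => hv i, hv0⟩ (S t) hCp (by rw [← map_mul, ht2, map_one])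
    have hu' : ∀ i, T i u = ε i • u := fun i => hu i (Finset.mem_univ i)
    refine ⟨1, u, P, ε, hu0, hu', hP u hu', fun s => ?_⟩
    by_cases hsε : ∀ i, ε (s.1 i) = ε i
    · rcases hs s hsε with rfl | rfl
      · simp
      · rw [hη]
        rcases Int.units_eq_one_or η with rfl | rfl <;> simp
    · exact Or.inr (Or.inr (hPS s u hu' hsε))
  · obtain ⟨u, hu, hu0, μ, hμ⟩ := exists_eigenvector_mem (signedEigenspace T ε Finset.univ)
      ⟨v, fun i _ => hv i, hv0⟩ (S t) hCp
    have hu' : ∀ i, T i u = ε i • u := fun i => hu i (Finset.mem_univ i)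
    have hμ3 : μ ^ 3 = 1 := eigenvalue_pow_eq_one hu0 hμ (by rw [← map_pow, ht3, map_one])
    refine ⟨cubicChar (Units.ofPowEqOne μ 3 hμ3 (by norm_num)) (by ext; simp), u, P, ε,
      hu0, hu', hP u hu', fun s => ?_⟩
    by_cases hsε : ∀ i, ε (s.1 i) = ε i
    · left
      conv_lhs => rw [hs s hsε, map_pow, pow_apply_of_eigenvector hμ]
      simp [cubicChar, Units.smul_def]
    · exact Or.inr (Or.inr (hPS s u hu' hsε))

theorem exists_signed_stabilizer_of_const [CharZero k] [IsAlgClosed k] [FiniteDimensional k E]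
    (S : alternatingGroup (Fin 4) →* Module.End k E)
    (p : Submodule k E) (hp : ∃ v ∈ p, v ≠ 0) (hSp : ∀ s, ∀ v ∈ p, S s v ∈ p) :
    ∃ (χ : alternatingGroup (Fin 4) →* kˣ) (u : E) (P : Module.End k E),
      u ≠ 0 ∧ u ∈ p ∧ P u = u ∧
      ∀ s, S s u = χ s • u ∨ S s u = -(χ s • u) ∨ P (S s u) = 0 := by
  obtain ⟨x, y, hx, hy, hxy, hx1, hy1, hxy1, hgen⟩ := exists_generators_kleinFour
  obtain ⟨v, hv, hv0, ε, hε⟩ := exists_common_signed_eigenvector p hp ![S x, S y]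
    (by intro i; fin_cases i <;> exact hSp _)
    (by intro i; fin_cases i <;> simp [← map_mul, hx, hy])
    (by intro i j; fin_cases i <;> fin_cases j <;> simp [← map_mul, hxy]) Finset.univ
  have hSx : S x v = ε 0 • v := hε 0 (Finset.mem_univ _)
  have hSy : S y v = ε 1 • v := hε 1 (Finset.mem_univ _)
  have hSxy : S (x * y) v = ε 0 • ε 1 • v := by
    rw [map_mul, Module.End.mul_apply, hSy, map_units_smul, hSx, smul_comm]
  have nontriv : ∀ n : alternatingGroup (Fin 4), n ≠ 1 → n * n = 1 → S n v = v →
      (∀ m, m * m = 1 → m ≠ 1 → m ≠ n → S m v = -v) →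
      ∃ (χ : alternatingGroup (Fin 4) →* kˣ) (u : E) (P : Module.End k E),
        u ≠ 0 ∧ u ∈ p ∧ P u = u ∧
        ∀ s, S s u = χ s • u ∨ S s u = -(χ s • u) ∨ P (S s u) = 0 := by
    intro n hn1 hn hnv hm
    refine ⟨1, v, (2⁻¹ : k) • (1 + S n), hv0, hv, ?_, fun s => ?_⟩
    · rw [LinearMap.smul_apply, LinearMap.add_apply, Module.End.one_apply, hnv, ← two_smul k v,
        smul_smul]
      norm_num
    · by_cases hs : s * s = 1
      · by_cases hs1 : s = 1
        · simp [hs1]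
        by_cases hsn : s = n
        · simp [hsn, hnv]
        · simp [hm s hs hs1 hsn]
      · right; right
        have h1 : S (s⁻¹ * n * s) v = -v := by
          refine hm _ ?_ ?_ (conj_ne_of_not_involutive s n hn hn1 hs)
          · rw [show s⁻¹ * n * s * (s⁻¹ * n * s) = s⁻¹ * (n * n) * s by group, hn]
            group
          · intro h
            apply hn1
            rw [show n = s * (s⁻¹ * n * s) * s⁻¹ by group, h]
            group
        have h2 : S n (S s v) = S s (S (s⁻¹ * n * s) v) := by
          simp only [← Module.End.mul_apply, ← map_mul]
          group
        rw [LinearMap.smul_apply, LinearMap.add_apply, Module.End.one_apply, h2, h1]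
        simp
  rcases Int.units_eq_one_or (ε 0) with h0 | h0 <;> rcases Int.units_eq_one_or (ε 1) with h1 | h1 <;>
    simp only [h0, h1, one_smul, neg_neg, Units.neg_smul] at hSx hSy hSxy
  · obtain ⟨c, hc, hcs⟩ := exists_kleinFour_mul_pow
    have hV : ∀ m, m * m = 1 → S m v = v := by
      intro m hm
      rcases hgen m hm with rfl | rfl | rfl | rfl
      exacts [by simp, hSx, hSy, hSxy]
    obtain ⟨u, hu, hu0, μ, hμ⟩ := exists_eigenvector_mem
      (p ⊓ signedEigenspace S 1 (Finset.univ.filter fun m => m * m = 1))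
      ⟨v, ⟨hv, fun m hm => by simpa using hV m (by simpa using hm)⟩, hv0⟩ (S c)
      (fun w hw => ⟨hSp c w hw.1, fun m hm => by
        have h2 : S m (S c w) = S c (S (c⁻¹ * m * c) w) := by
          simp only [← Module.End.mul_apply, ← map_mul]
          group
        have hm : m * m = 1 := by simpa using hm
        rw [h2, hw.2 (c⁻¹ * m * c)]
        · simp
        · simp only [Finset.mem_filter, Finset.mem_univ, true_and]
          rw [show c⁻¹ * m * c * (c⁻¹ * m * c) = c⁻¹ * (m * m) * c by group, hm]
          group⟩)
    have hμ3 : μ ^ 3 = 1 := eigenvalue_pow_eq_one hu0 hμ (by rw [← map_pow, hc, map_one])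
    refine ⟨cubicChar (Units.ofPowEqOne μ 3 hμ3 (by norm_num)) (by ext; simp), u, 1,
      hu0, hu.1, rfl, fun s => Or.inl ?_⟩
    obtain ⟨n, hn, hs⟩ := hcs s
    have hnu : S n u = u := by simpa using hu.2 n (by simpa using hn)
    conv_lhs => rw [hs, map_mul, map_pow, Module.End.mul_apply, pow_apply_of_eigenvector hμ,
      map_smul, hnu]
    simp [cubicChar, Units.smul_def]
  · refine nontriv x hx1 hx hSx fun m hm hm1 hmn => ?_
    rcases hgen m hm with rfl | rfl | rfl | rfl
    exacts [absurd rfl hm1, absurd rfl hmn, hSy, hSxy]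
  · refine nontriv y hy1 hy hSy fun m hm hm1 hmn => ?_
    rcases hgen m hm with rfl | rfl | rfl | rfl
    exacts [absurd rfl hm1, hSx, absurd rfl hmn, hSxy]
  · refine nontriv (x * y) hxy1 (by rw [mul_assoc, ← mul_assoc y, ← hxy, mul_assoc, hy, mul_one, hx]) hSxy fun m hm hm1 hmn => ?_
    rcases hgen m hm with rfl | rfl | rfl | rfl
    exacts [absurd rfl hm1, hSx, hSy, absurd rfl hmn]

theorem exists_signed_stabilizer [CharZero k] [IsAlgClosed k] [FiniteDimensional k E] [Nontrivial E]
    (S : alternatingGroup (Fin 4) →* Module.End k E) (T : Fin 4 → Module.End k E)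
    (hT : ∀ i, T i * T i = 1) (hcomm : ∀ i j, T i * T j = T j * T i)
    (hST : ∀ s i, S s * T i = T (s.1 i) * S s) :
    ∃ (χ : alternatingGroup (Fin 4) →* kˣ) (u : E) (P : Module.End k E) (ε : Fin 4 → ℤˣ),
      u ≠ 0 ∧ (∀ i, T i u = ε i • u) ∧ P u = u ∧
      ∀ s, S s u = χ s • u ∨ S s u = -(χ s • u) ∨ P (S s u) = 0 := by
  obtain ⟨v₀, hv₀⟩ := exists_ne (0 : E)
  obtain ⟨v, -, hv0, ε, hv⟩ := exists_common_signed_eigenvector ⊤ ⟨v₀, trivial, hv₀⟩ T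
    (fun _ _ _ => trivial) hT hcomm Finset.univ
  rcases stabilizer_cyclic_of_not_const ε with hε | ⟨t, ht, h⟩
  · obtain ⟨χ, u, P, hu0, hu, hP, h⟩ := exists_signed_stabilizer_of_const S
      (signedEigenspace T ε Finset.univ) ⟨v, hv, hv0⟩ (fun s w hw i _ => by
        have h1 : T (s.1 (s.1.symm i)) (S s w) = ε (s.1.symm i) • S s w := by
          rw [← Module.End.mul_apply, ← hST, Module.End.mul_apply, hw _ (Finset.mem_univ _),
            map_units_smul]
        rw [hε, ← hε i] at h1
        simpa using h1)
    exact ⟨χ, u, P, ε, hu0, fun i => hu i (Finset.mem_univ i), hP, h⟩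
  · exact exists_signed_stabilizer_of_not_const S T hST (fun i => hv i (Finset.mem_univ i)) hv0 ht h

end

theorem exists_signed_stabilizer_semidirectProduct {k : Type} [Field k] [CharZero k] [IsAlgClosed k]
    {E : Type} [AddCommGroup E] [Module k E] [FiniteDimensional k E] [Nontrivial E]
    (ρ : Representation k (SemidirectProduct (Multiplicative (Fin 4 → ZMod 2))
      (alternatingGroup (Fin 4)) thetaA4) E) :
    ∃ (χ : alternatingGroup (Fin 4) →* kˣ) (u : E) (P : Module.End k E), u ≠ 0 ∧ P u = u ∧
      ∀ w, ρ w u = χ w.right • u ∨ ρ w u = -(χ w.right • u) ∨ P (ρ w u) = 0 := by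
  let t : Fin 4 → Multiplicative (Fin 4 → ZMod 2) := fun i => Multiplicative.ofAdd (Pi.single i 1)
  have ht : ∀ i, t i * t i = 1 := by decide
  have hθ : ∀ s i, thetaA4 s (t i) = t (s.1 i) := by decide +kernel
  obtain ⟨χ, u, P, ε, hu0, hu, hP, h⟩ := exists_signed_stabilizer
    (ρ.comp SemidirectProduct.inr) (fun i => ρ (SemidirectProduct.inl (t i)))
    (fun i => by rw [← map_mul, ← map_mul, ht, map_one, map_one])
    (fun i j => by
      rw [← map_mul ρ, ← map_mul ρ, ← map_mul SemidirectProduct.inl,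
        ← map_mul SemidirectProduct.inl, mul_comm (t i)])
    (fun s i => by
      rw [MonoidHom.comp_apply, ← map_mul, ← map_mul, ← hθ, SemidirectProduct.inl_aut]
      simp)
  refine ⟨χ, u, P, hu0, hP, fun w => ?_⟩
  have hinv : ∀ a : Multiplicative (Fin 4 → ZMod 2), a⁻¹ = a := by decide +kernel
  let K : Subgroup (Multiplicative (Fin 4 → ZMod 2)) :=
    { carrier := {f | ∃ η : ℤˣ, ρ (SemidirectProduct.inl f) u = η • u}
      one_mem' := ⟨1, by simp⟩
      mul_mem' := by
        rintro a b ⟨η, hη⟩ ⟨η', hη'⟩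
        exact ⟨η' * η, by
          rw [map_mul, map_mul, Module.End.mul_apply, hη', map_units_smul, hη, smul_smul]⟩
      inv_mem' := by
        rintro a ⟨η, hη⟩
        rw [hinv]
        exact ⟨η, hη⟩ }
  have hK : ∀ f, f ∈ K := by
    intro f
    have hf : f = ∏ i, (t i) ^ (Multiplicative.toAdd f i).val := by revert f; decide +kernel
    rw [hf]
    exact K.prod_mem fun i _ => K.pow_mem ⟨ε i, hu i⟩ _
  obtain ⟨η, hη⟩ := hK (thetaA4 w.right⁻¹ w.left)
  have hw : w = SemidirectProduct.inr w.right *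
      SemidirectProduct.inl (thetaA4 w.right⁻¹ w.left) := by
    ext <;> simp
  have hρ : ρ w u = η • ρ (SemidirectProduct.inr w.right) u := by
    conv_lhs => rw [hw, map_mul, Module.End.mul_apply, hη, map_units_smul]
  have hs := h w.right
  simp only [MonoidHom.comp_apply] at hs
  rw [hρ]
  rcases Int.units_eq_one_or η with rfl | rfl
  · simpa using hs
  · simp only [Units.neg_smul, one_smul, neg_inj, map_neg, neg_eq_zero]
    rcases hs with hs | hs | hs
    · exact Or.inr (Or.inl hs)
    · exact Or.inl (neg_eq_iff_eq_neg.2 hs)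
    · exact Or.inr (Or.inr hs)

/-- The homomorphism `V ⋊ A₄ → ℤ/2` given by the sum of the coordinates on `V`. -/
def coordinateSum : SemidirectProduct (Multiplicative (Fin 4 → ZMod 2))
    (alternatingGroup (Fin 4)) thetaA4 →* Multiplicative (ZMod 2) where
  toFun w := Multiplicative.ofAdd (∑ i, Multiplicative.toAdd w.left i)
  map_one' := by simp
  map_mul' x y := by
    have : ∑ i, Multiplicative.toAdd (thetaA4 x.right y.left) i =
        ∑ i, Multiplicative.toAdd y.left i :=
      Equiv.sum_comp x.right.1.symm (Multiplicative.toAdd y.left)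
    simp [Finset.sum_add_distrib, this]

theorem exists_surjective_of_cases (H : Type) [Group H]
    (hH : Nonempty (H ≃* ↥(alternatingGroup (Fin 4))) ∨
      Nonempty (H ≃* Multiplicative (ZMod 2) × ↥(alternatingGroup (Fin 4))) ∨
      Nonempty (H ≃* SemidirectProduct (Multiplicative (Fin 4 → ZMod 2))
        ↥(alternatingGroup (Fin 4)) thetaA4)) :
    ∃ (φ : SemidirectProduct (Multiplicative (Fin 4 → ZMod 2))
        ↥(alternatingGroup (Fin 4)) thetaA4 →* H) (π : H →* alternatingGroup (Fin 4)),
      Function.Surjective φ ∧ ∀ w, π (φ w) = w.right := by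
  rcases hH with ⟨⟨e⟩⟩ | ⟨⟨e⟩⟩ | ⟨⟨e⟩⟩
  · exact ⟨e.symm.toMonoidHom.comp SemidirectProduct.rightHom, e.toMonoidHom,
      e.symm.surjective.comp SemidirectProduct.rightHom_surjective, fun w => by simp⟩
  · refine ⟨e.symm.toMonoidHom.comp (coordinateSum.prod SemidirectProduct.rightHom),
      (MonoidHom.snd _ _).comp e.toMonoidHom, e.symm.surjective.comp ?_, fun w => by simp⟩
    rintro ⟨z, s⟩
    refine ⟨⟨Multiplicative.ofAdd (Pi.single 0 (Multiplicative.toAdd z)), s⟩, Prod.ext ?_ rfl⟩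
    change Multiplicative.ofAdd (∑ i, (Pi.single 0 (Multiplicative.toAdd z) : Fin 4 → ZMod 2) i) =
      z
    simp
  · exact ⟨e.symm.toMonoidHom, SemidirectProduct.rightHom.comp e.toMonoidHom, e.symm.surjective,
      fun w => by simp⟩

/-- Let `Γ = A₄` and let `H = V ⋊ Γ`, where `V` is (i) trivial, (ii) `ℤ/2` with trivial
`Γ`-action, or (iii) the `𝔽₂`-vector space with basis `{a,b,c,d}` permuted by `Γ` (in cases (i)
and (ii) the semidirect product is a direct product).  Then every simple `ℚ̄[H]`-module `E` is
isomorphic to `E′ ⊗ E″` where `E′` is defined over `ℚ` (it has the same character as the scalar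
extension of a `ℚ[H]`-module, which over characteristic zero determines it up to isomorphism)
and `E″` is one-dimensional. -/
theorem stmt15 (H : Type) [Group H]
    (hH : Nonempty (H ≃* ↥(alternatingGroup (Fin 4))) ∨
      Nonempty (H ≃* Multiplicative (ZMod 2) × ↥(alternatingGroup (Fin 4))) ∨
      Nonempty (H ≃* SemidirectProduct (Multiplicative (Fin 4 → ZMod 2))
        ↥(alternatingGroup (Fin 4)) thetaA4))
    (E : FDRep (AlgebraicClosure ℚ) H) (hE : Simple E) :
    ∃ E' E'' : FDRep (AlgebraicClosure ℚ) H,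
      (∃ F : FDRep ℚ H, ∀ g,
        FDRep.character E' g = algebraMap ℚ (AlgebraicClosure ℚ) (FDRep.character F g)) ∧
      Module.finrank (AlgebraicClosure ℚ) E'' = 1 ∧
      Nonempty (E ≅ E' ⊗ E'') := by
  obtain ⟨φ, π, hφ, hπ⟩ := exists_surjective_of_cases H hH
  have : Nontrivial E := by
    by_contra hE'
    rw [not_nontrivial_iff_subsingleton] at hE'
    apply Simple.not_isZero E
    rw [Limits.IsZero.iff_id_eq_zero]
    ext x
    exact Subsingleton.elim (α := E) _ _
  obtain ⟨χ, u, P, hu0, hP, h⟩ := exists_signed_stabilizer_semidirectProduct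
    (MonoidHom.comp E.ρ φ : Representation _ _ E)
  let lam : H →* (AlgebraicClosure ℚ)ˣ := χ.comp π
  let ρ' : Representation (AlgebraicClosure ℚ) H E :=
    { toFun := fun g => ((lam g)⁻¹ : (AlgebraicClosure ℚ)ˣ) • E.ρ g
      map_one' := by simp
      map_mul' := fun x y => by
        rw [map_mul, map_mul, smul_mul_smul_comm, mul_inv] }
  have hρ' : ∀ g v, ρ' g v = (lam g)⁻¹ • E.ρ g v := fun g v => rfl
  have hρ : ∀ g v, lam g • ρ' g v = E.ρ g v := fun g v => by rw [hρ', smul_inv_smul]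
  obtain ⟨E'', hE'', hiso⟩ := E.exists_iso_tensor_twist lam ρ' hρ
  refine ⟨FDRep.of ρ', E'', ?_, hE'', hiso⟩
  have hspan : Submodule.span (AlgebraicClosure ℚ) (Set.range fun g => ρ' g u) = ⊤ := by
    rw [eq_top_iff, ← E.span_orbit_eq_top hu0, Submodule.span_le]
    rintro _ ⟨g, rfl⟩
    simp only [← hρ]
    exact Submodule.smul_mem _ (lam g : AlgebraicClosure ℚ) (Submodule.subset_span ⟨g, rfl⟩)
  refine exists_fdRep_character_eq_of_signed_stabilizer ρ' hu0 hspan P hP fun g => ?_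
  obtain ⟨w, rfl⟩ := hφ g
  have hlam : lam (φ w) = χ w.right := by simp [lam, hπ]
  have hw := h w
  simp only [MonoidHom.comp_apply] at hw
  rw [hρ', hlam]
  rcases hw with hw | hw | hw
  · left
    rw [hw, inv_smul_smul]
  · right; left
    rw [hw, smul_neg, inv_smul_smul]
  · right; right
    rw [Units.smul_def, map_smul, hw, smul_zero]
end

section
/- If G/N is abelian and Z(N) = {1}, then every g ∈ G such that g·g₁·g⁻¹·g₁⁻¹ ∈ Z(G) for all g₁ ∈ G lies in Z(G); equivalently, the center of G/Z(G) is trivial. -/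
/-- If `G/N` is abelian and `Z(N) = {1}`, then every `g ∈ G` such that
`g * g₁ * g⁻¹ * g₁⁻¹ ∈ Z(G)` for all `g₁ ∈ G` lies in `Z(G)`; equivalently, the center of
`G / Z(G)` is trivial. -/
theorem stmt16 (G : Type*) [Group G] (N : Subgroup G) [N.Normal]
    (habelian : ∀ x y : G ⧸ N, x * y = y * x)
    (hZN : Subgroup.center ↥N = ⊥) :
    (∀ g : G, (∀ g₁ : G, g * g₁ * g⁻¹ * g₁⁻¹ ∈ Subgroup.center G) → g ∈ Subgroup.center G) ∧
      Subgroup.center (G ⧸ Subgroup.center G) = ⊥ := by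
  have key : ∀ g : G, (∀ g₁ : G, g * g₁ * g⁻¹ * g₁⁻¹ ∈ Subgroup.center G) →
      g ∈ Subgroup.center G := by
    intro g hg
    rw [Subgroup.mem_center_iff]
    intro h
    have hN : g * h * g⁻¹ * h⁻¹ ∈ N := by
      rw [← QuotientGroup.eq_one_iff]
      simp only [QuotientGroup.mk_mul, QuotientGroup.mk_inv]
      rw [habelian (g : G ⧸ N) h]
      group
    have hc : (⟨_, hN⟩ : N) ∈ Subgroup.center N :=
      Subgroup.mem_center_iff.2 fun n ↦ Subtype.ext (Subgroup.mem_center_iff.1 (hg h) n)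
    rw [hZN, Subgroup.mem_bot] at hc
    have hone : g * h * g⁻¹ * h⁻¹ = 1 := congrArg Subtype.val hc
    rw [mul_inv_eq_one, mul_inv_eq_iff_eq_mul] at hone
    exact hone.symm
  refine ⟨key, (Subgroup.eq_bot_iff_forall _).2 fun x hx ↦ ?_⟩
  induction x using QuotientGroup.induction_on with
  | H g =>
    rw [QuotientGroup.eq_one_iff]
    refine key g fun h ↦ ?_
    rw [← QuotientGroup.eq_one_iff]
    simp only [QuotientGroup.mk_mul, QuotientGroup.mk_inv]
    rw [← Subgroup.mem_center_iff.1 hx h]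
    group
end
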